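/- Let Ω, Ω′ ⊂ ℝⁿ be bounded domains and assume the mapping φ : Ω → Ω̄′ induces a bounded composition operator φ* : L¹_p(Ω′) ∩ Lip(Ω′) → L¹_q(Ω) with 1 ≤ q < p ≤ ∞. Define, for bounded open sets A′ ⊂ ℝⁿ with A′ ∩ Ω′ ≠ ∅, Φ(A′) = sup over f ∈ L̊¹_p(A′) ∩ Lip(A′) of ( ‖φ* f | L¹_q(Ω)‖ / ‖f | L¹_p(A′ ∩ Ω′)‖ )^σ, where σ = pq/(p−q) if p < ∞ and σ = q if p = ∞. Then Φ is a bounded, monotone, countably additive function on the bounded open sets A′ with A′ ∩ Ω′ ≠ ∅: Φ(V) ≤ Φ(U) whenever V ⊂ U, and Σ_{i=1}^∞ Φ(U_i) = Φ(⋃_{i=1}^∞ U_i) for any countable family of pairwise disjoint open sets U_i contained in an open set U. -/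

import Mathlib

open MeasureTheory Set Filter Topology Metric Matrix
open scoped ENNReal NNReal

noncomputable section

/-- Euclidean space `ℝⁿ`. -/
abbrev Ev (n : ℕ) := EuclideanSpace ℝ (Fin n)

/-- `n × n` real matrices. -/
abbrev Mat (n : ℕ) := Matrix (Fin n) (Fin n) ℝ

namespace Paper

variable {n : ℕ}

/-- Frobenius norm of a matrix. -/
def matNorm {n : ℕ} (A : Mat n) : ℝ := Real.sqrt (∑ i, ∑ j, (A i j) ^ 2)

/-- A bounded domain: a nonempty connected open bounded set. -/
def IsBoundedDomain {n : ℕ} (Ω : Set (Ev n)) : Prop :=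
  IsOpen Ω ∧ IsConnected Ω ∧ Bornology.IsBounded Ω

/-- `Ω` has Lipschitz boundary: near each boundary point, in some Cartesian coordinate
system (an affine isometry of `ℝⁿ`), `Ω` is the subgraph of a Lipschitz function of the
remaining `n − 1` coordinates. -/
def HasLipschitzBoundary {n : ℕ} (Ω : Set (Ev n)) : Prop :=
  ∀ x ∈ frontier Ω, ∃ U : Set (Ev n), IsOpen U ∧ x ∈ U ∧
    ∃ (e : Ev n ≃ᵃⁱ[ℝ] Ev n) (i : Fin n) (f : Ev n → ℝ) (L : ℝ≥0),
      LipschitzWith L f ∧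
      (∀ y z : Ev n, (∀ j : Fin n, j ≠ i → y j = z j) → f y = f z) ∧
      Ω ∩ U = {y ∈ U | e y i < f (e y)}

/-- `Df` is the weak (distributional) derivative of `f : Ω → ℝⁿ` on the open set `Ω`. -/
def IsWeakDeriv {n : ℕ} (Ω : Set (Ev n)) (f : Ev n → Ev n) (Df : Ev n → Mat n) : Prop :=
  (∀ i j : Fin n, LocallyIntegrableOn (fun x => Df x i j) Ω) ∧
  ∀ η : Ev n → ℝ, ContDiff ℝ (⊤ : ℕ∞) η → HasCompactSupport η → tsupport η ⊆ Ω →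
    ∀ i j : Fin n,
      ∫ x in Ω, f x i * fderiv ℝ η x (EuclideanSpace.single j 1)
        = - ∫ x in Ω, Df x i j * η x

/-- `Du` is the weak gradient of the scalar function `u` on the open set `Ω`. -/
def IsWeakGrad {n : ℕ} (Ω : Set (Ev n)) (u : Ev n → ℝ) (Du : Ev n → Ev n) : Prop :=
  (∀ j : Fin n, LocallyIntegrableOn (fun x => Du x j) Ω) ∧
  ∀ η : Ev n → ℝ, ContDiff ℝ (⊤ : ℕ∞) η → HasCompactSupport η → tsupport η ⊆ Ω →
    ∀ j : Fin n,
      ∫ x in Ω, u x * fderiv ℝ η x (EuclideanSpace.single j 1)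
        = - ∫ x in Ω, Du x j * η x

/-- Membership in the local Sobolev class `W¹_{p,loc}(Ω)` (for mappings `Ω → ℝⁿ`),
with given weak derivative `Df`. -/
def MemW1loc {n : ℕ} (p : ℝ) (Ω : Set (Ev n)) (f : Ev n → Ev n) (Df : Ev n → Mat n) : Prop :=
  LocallyIntegrableOn f Ω ∧ IsWeakDeriv Ω f Df ∧
  ∀ K : Set (Ev n), IsCompact K → K ⊆ Ω →
    ∫⁻ x in K, ENNReal.ofReal (matNorm (Df x) ^ p) < ⊤

/-- Membership in the Sobolev class `W¹_p(Ω)` (global integrability over `Ω`),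
with given weak derivative `Df`. -/
def MemW1 {n : ℕ} (p : ℝ) (Ω : Set (Ev n)) (f : Ev n → Ev n) (Df : Ev n → Mat n) : Prop :=
  IntegrableOn f Ω volume ∧ IsWeakDeriv Ω f Df ∧
  ∫⁻ x in Ω, ENNReal.ofReal (matNorm (Df x) ^ p) < ⊤

/-- `φ` is a homeomorphism of `Ω` onto `Ω'` with (two-sided) inverse `ψ`. -/
structure IsHomeoOn {n : ℕ} (φ ψ : Ev n → Ev n) (Ω Ω' : Set (Ev n)) : Prop where
  cont : ContinuousOn φ Ω
  cont_inv : ContinuousOn ψ Ω'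
  mapsTo : MapsTo φ Ω Ω'
  mapsTo_inv : MapsTo ψ Ω' Ω
  left_inv : ∀ x ∈ Ω, ψ (φ x) = x
  right_inv : ∀ y ∈ Ω', φ (ψ y) = y

/-- `φ` is a homeomorphism of `Ω` onto `Ω'`. -/
def IsHomeo {n : ℕ} (φ : Ev n → Ev n) (Ω Ω' : Set (Ev n)) : Prop :=
  ∃ ψ : Ev n → Ev n, IsHomeoOn φ ψ Ω Ω'

/-- A mapping (given through its weak derivative `Df`) has finite distortion on `Ω`:
`|Df(x)|ⁿ ≤ K(x)·|J(x,f)|` a.e. with `1 ≤ K(x) < ∞` a.e. -/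
def HasFiniteDistortionOn (n : ℕ) (Ω : Set (Ev n)) (Df : Ev n → Mat n) : Prop :=
  ∃ K : Ev n → ℝ, (∀ᵐ x ∂(volume.restrict Ω), 1 ≤ K x) ∧
    ∀ᵐ x ∂(volume.restrict Ω), matNorm (Df x) ^ n ≤ K x * |(Df x).det|

/-- Finite codistortion: `Adj Df(x) = 0` a.e. on the zero set of the Jacobian. -/
def HasFiniteCodistortionOn (n : ℕ) (Ω : Set (Ev n)) (Df : Ev n → Mat n) : Prop :=
  ∀ᵐ x ∂(volume.restrict Ω), (Df x).det = 0 → (Df x).adjugate = 0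

/-- Outer distortion coefficient `K_O(x,f) = |Df(x)|ⁿ / J(x,f)` (`= 1` off `{0 < J < ∞}`). -/
def KO (n : ℕ) (Df : Ev n → Mat n) (x : Ev n) : ℝ :=
  if 0 < (Df x).det then matNorm (Df x) ^ n / (Df x).det else 1

/-- Inner distortion coefficient `K_I(x,f) = |Adj Df(x)|ⁿ / J(x,f)^{n−1}`
(`= 1` off `{0 < J < ∞}`). -/
def KI (n : ℕ) (Df : Ev n → Mat n) (x : Ev n) : ℝ :=
  if 0 < (Df x).det then matNorm ((Df x).adjugate) ^ n / (Df x).det ^ (n - 1) else 1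

/-- Outer distortion operator function `K_{f,p}(x) = |Df(x)| / |J(x,f)|^{1/p}`,
equal to `0` on the zero set of the Jacobian. -/
def KopOuter (p : ℝ≥0∞) (Df : Ev n → Mat n) (x : Ev n) : ℝ :=
  if (Df x).det = 0 then 0
  else matNorm (Df x) / |(Df x).det| ^ (1 / p.toReal)

/-- Inner distortion operator function `𝒦_{f,p}(x) = |Adj Df(x)| / |J(x,f)|^{(n−1)/p}`,
equal to `0` on the zero set of the Jacobian. -/
def KopInner (n : ℕ) (p : ℝ≥0∞) (Df : Ev n → Mat n) (x : Ev n) : ℝ :=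
  if (Df x).det = 0 then 0
  else matNorm ((Df x).adjugate) / |(Df x).det| ^ (((n : ℝ) - 1) / p.toReal)

/-- The coefficient vector of the pullback `f̃*ω` of an `(n−1)`-form (identified with its
coefficient vector `a`), extended by `0` on the zero set of the Jacobian:
`(f̃*ω)(x) = Adj Dφ(x) ⬝ a(φ(x))`. -/
def pullbackCoeff {n : ℕ} (φ : Ev n → Ev n) (Dφ : Ev n → Mat n) (a : Ev n → Ev n)
    (x : Ev n) : Ev n :=
  if (Dφ x).det = 0 then 0
  else (WithLp.equiv 2 (∀ _ : Fin n, ℝ)).symm ((Dφ x).adjugate.mulVec (fun j => a (φ x) j))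

/-- `φ` induces a pullback operator
`φ̃* : 𝓛_p(Ω', Λ^{n−1}) → 𝓛_q(Ω, Λ^{n−1})` of norm at most `C`. -/
def PullbackBounded {n : ℕ} (Ω Ω' : Set (Ev n)) (φ : Ev n → Ev n) (Dφ : Ev n → Mat n)
    (p q : ℝ≥0∞) (C : ℝ≥0∞) : Prop :=
  ∀ a : Ev n → Ev n, Measurable a →
    eLpNorm (pullbackCoeff φ Dφ a) q (volume.restrict Ω)
      ≤ C * eLpNorm a p (volume.restrict Ω')

/-- The operator norm of the pullback operator `φ̃*` from `𝓛_p(Ω')` to `𝓛_q(Ω)`. -/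
def pullbackOpNorm {n : ℕ} (Ω Ω' : Set (Ev n)) (φ : Ev n → Ev n) (Dφ : Ev n → Mat n)
    (p q : ℝ≥0∞) : ℝ≥0∞ :=
  sInf {C : ℝ≥0∞ | PullbackBounded Ω Ω' φ Dφ p q C}

/-- `φ : Ω → Ω'` induces a bounded composition operator
`φ* : L¹_p(Ω') ∩ Lip_loc(Ω') → L¹_q(Ω)`, `φ*(u) = u ∘ φ`, with norm at most `C`. -/
def CompOpBounded {n : ℕ} (Ω Ω' : Set (Ev n)) (φ : Ev n → Ev n)
    (p q : ℝ≥0∞) (C : ℝ≥0∞) : Prop :=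
  ∀ (u : Ev n → ℝ) (Du : Ev n → Ev n),
    (∀ K : Set (Ev n), IsCompact K → K ⊆ Ω' → ∃ L : ℝ≥0, LipschitzOnWith L u K) →
    IsWeakGrad Ω' u Du →
    eLpNorm Du p (volume.restrict Ω') < ⊤ →
    ∃ Dv : Ev n → Ev n, IsWeakGrad Ω (u ∘ φ) Dv ∧
      eLpNorm Dv q (volume.restrict Ω) ≤ C * eLpNorm Du p (volume.restrict Ω')

/-- The operator norm of the composition operator `φ* : L¹_p(Ω') → L¹_q(Ω)`. -/
def compOpNorm {n : ℕ} (Ω Ω' : Set (Ev n)) (φ : Ev n → Ev n) (p q : ℝ≥0∞) : ℝ≥0∞ :=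
  sInf {C : ℝ≥0∞ | CompOpBounded Ω Ω' φ p q C}

/-- `φ : Ω → Ω'` induces a bounded composition operator
`φ* : L¹_p(Ω') ∩ Lip(Ω') → L¹_q(Ω)` with norm at most `C` (globally Lipschitz test
functions). -/
def CompOpBoundedLip {n : ℕ} (Ω Ω' : Set (Ev n)) (φ : Ev n → Ev n)
    (p q : ℝ≥0∞) (C : ℝ≥0∞) : Prop :=
  ∀ (u : Ev n → ℝ) (Du : Ev n → Ev n) (L : ℝ≥0),
    LipschitzOnWith L u Ω' →
    IsWeakGrad Ω' u Du →
    eLpNorm Du p (volume.restrict Ω') < ⊤ →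
    ∃ Dv : Ev n → Ev n, IsWeakGrad Ω (u ∘ φ) Dv ∧
      eLpNorm Dv q (volume.restrict Ω) ≤ C * eLpNorm Du p (volume.restrict Ω')

/-- Weak convergence `f_k ⇀ f₀` in `W¹_{p,loc}(Ω)`: all the mappings belong to
`W¹_{p,loc}(Ω)`, the `W¹_p`-norms are bounded on compact subsets, and functions and
weak derivatives converge as distributions. -/
def WeakConvW1loc {n : ℕ} (p : ℝ) (Ω : Set (Ev n))
    (f : ℕ → Ev n → Ev n) (Df : ℕ → Ev n → Mat n)
    (f0 : Ev n → Ev n) (Df0 : Ev n → Mat n) : Prop :=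
  (∀ k, MemW1loc p Ω (f k) (Df k)) ∧ MemW1loc p Ω f0 Df0 ∧
  (∀ K : Set (Ev n), IsCompact K → K ⊆ Ω → ∃ C : ℝ,
    ∀ k, (∫⁻ x in K, ENNReal.ofReal (matNorm (Df k x) ^ p)) ≤ ENNReal.ofReal C) ∧
  ∀ θ : Ev n → ℝ, ContDiff ℝ (⊤ : ℕ∞) θ → HasCompactSupport θ → tsupport θ ⊆ Ω →
    (∀ i : Fin n,
      Tendsto (fun k => ∫ x in Ω, θ x * f k x i) atTop (𝓝 (∫ x in Ω, θ x * f0 x i))) ∧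
    (∀ i j : Fin n,
      Tendsto (fun k => ∫ x in Ω, θ x * Df k x i j) atTop (𝓝 (∫ x in Ω, θ x * Df0 x i j)))

/-- `φ` is injective almost everywhere on `Ω`: injective outside some negligible set. -/
def AEInjectiveOn {n : ℕ} (φ : Ev n → Ev n) (Ω : Set (Ev n)) : Prop :=
  ∃ S : Set (Ev n), S ⊆ Ω ∧ volume S = 0 ∧ Set.InjOn φ (Ω \ S)

end Paper

namespace Paper

/-- The class `L̊¹_p(A) ∩ Lip`: weak-gradient pairs `(f, Df)` on `ℝⁿ` with `f = 0`
off `A`, finite `L¹_p`-seminorm, approximable by smooth compactly supported functions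
in `A` in the `L¹_p`-seminorm. -/
def MemL1pZero {n : ℕ} (p : ℝ≥0∞) (A : Set (Ev n)) (f : Ev n → ℝ) (Df : Ev n → Ev n) : Prop :=
  IsWeakGrad Set.univ f Df ∧ (∀ x ∉ A, f x = 0) ∧
  eLpNorm Df p volume < ⊤ ∧
  ∀ ε : ℝ, 0 < ε → ∃ g : Ev n → ℝ, ContDiff ℝ (⊤ : ℕ∞) g ∧ HasCompactSupport g ∧
    tsupport g ⊆ A ∧
    eLpNorm (fun x => Df x - gradient g x) p volume < ENNReal.ofReal ε

/-- The set function
`Φ(A') = sup_{f ∈ L̊¹_p(A') ∩ Lip(A')} ( ‖φ*f | L¹_q(Ω)‖ / ‖f | L¹_p(A' ∩ Ω')‖ )^σ`. -/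
def PhiFun {n : ℕ} (Ω Ω' : Set (Ev n)) (φ : Ev n → Ev n) (p q : ℝ≥0∞) (σ : ℝ)
    (A : Set (Ev n)) : ℝ :=
  sSup {t : ℝ | ∃ (f : Ev n → ℝ) (Df : Ev n → Ev n) (L : ℝ≥0) (Dv : Ev n → Ev n),
    MemL1pZero p A f Df ∧ LipschitzOnWith L f A ∧
    IsWeakGrad Ω (f ∘ φ) Dv ∧
    t = ((eLpNorm Dv q (volume.restrict Ω)).toReal /
         (eLpNorm Df p (volume.restrict (A ∩ Ω'))).toReal) ^ σ}

/-- A locally integrable function times a test function is integrable. -/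
lemma integrable_mul_of_tsupport_subset {n : ℕ} {Ω : Set (Ev n)} {f η : Ev n → ℝ}
    (hf : LocallyIntegrableOn f Ω) (hη : Continuous η) (hc : HasCompactSupport η)
    (hs : tsupport η ⊆ Ω) : Integrable (fun x => f x * η x) := by
  have h1 : IntegrableOn f (tsupport η) := hf.integrableOn_compact_subset hs hc
  have h2 : IntegrableOn (fun x => f x * η x) (tsupport η) :=
    h1.mul_continuousOn hη.continuousOn hc
  rwa [integrableOn_iff_integrable_of_support_subset] at h2
  intro x hx
  apply subset_tsupport
  intro h
  simp [h] at hx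

/-- Directional derivatives of a smooth function are continuous. -/
lemma continuous_fderiv_apply {n : ℕ} {η : Ev n → ℝ} (hη : ContDiff ℝ (⊤ : ℕ∞) η) (v : Ev n) :
    Continuous (fun x => fderiv ℝ η x v) :=
  (hη.continuous_fderiv (by simp)).clm_apply continuous_const

lemma tsupport_fderiv_apply_subset {n : ℕ} (η : Ev n → ℝ) (v : Ev n) :
    tsupport (fun x => fderiv ℝ η x v) ⊆ tsupport η :=
  _root_.tsupport_fderiv_apply_subset ℝ v

lemma setIntegral_eq_integral_of_tsupport_subset {n : ℕ} {Ω : Set (Ev n)} {F η : Ev n → ℝ}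
    (hs : tsupport η ⊆ Ω) : ∫ x in Ω, F x * η x = ∫ x, F x * η x := by
  apply setIntegral_eq_integral_of_forall_compl_eq_zero
  intro x hx
  rw [image_eq_zero_of_notMem_tsupport (fun h => hx (hs h)), mul_zero]

lemma IsWeakGrad.aestronglyMeasurable {n : ℕ} {Ω : Set (Ev n)} {u : Ev n → ℝ} {D : Ev n → Ev n}
    (h : IsWeakGrad Ω u D) : AEStronglyMeasurable D (volume.restrict Ω) := by
  apply AEMeasurable.aestronglyMeasurable
  have h1 : AEMeasurable (fun x => WithLp.ofLp (D x)) (volume.restrict Ω) :=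
    aemeasurable_pi_iff.2 fun j => (h.1 j).aestronglyMeasurable.aemeasurable
  have h2 : Measurable (WithLp.toLp 2 : (Fin n → ℝ) → Ev n) := WithLp.measurable_toLp 2 _
  exact h2.comp_aemeasurable h1

lemma IsWeakGrad.ae_eq {n : ℕ} {Ω : Set (Ev n)} (hΩ : IsOpen Ω) {u : Ev n → ℝ} {D D' : Ev n → Ev n}
    (h : IsWeakGrad Ω u D) (h' : IsWeakGrad Ω u D') : D =ᵐ[volume.restrict Ω] D' := by
  have key : ∀ j : Fin n, ∀ᵐ x, x ∈ Ω → D x j - D' x j = 0 := by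
    intro j
    apply hΩ.ae_eq_zero_of_integral_contDiff_smul_eq_zero (μ := volume)
      (f := fun x => D x j - D' x j) ((h.1 j).sub (h'.1 j))
    intro η hη hc hs
    have h1 := (h.2 η hη hc hs j).symm.trans (h'.2 η hη hc hs j)
    rw [setIntegral_eq_integral_of_tsupport_subset hs,
      setIntegral_eq_integral_of_tsupport_subset hs] at h1
    have : ∫ x, η x • (D x j - D' x j) = ∫ x, (D x j * η x - D' x j * η x) := by
      congr 1; ext x; simp; ring
    rw [this, integral_sub (integrable_mul_of_tsupport_subset (h.1 j) hη.continuous hc hs)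
      (integrable_mul_of_tsupport_subset (h'.1 j) hη.continuous hc hs)]
    linarith
  rw [Filter.EventuallyEq, ae_restrict_iff' hΩ.measurableSet]
  filter_upwards [ae_all_iff.2 key] with x hx hxΩ
  ext j
  linarith [hx j hxΩ]

lemma IsWeakGrad.congr {n : ℕ} {Ω : Set (Ev n)} {u v : Ev n → ℝ} {D : Ev n → Ev n}
    (h : IsWeakGrad Ω u D) (huv : u =ᵐ[volume.restrict Ω] v) : IsWeakGrad Ω v D := by
  refine ⟨h.1, fun η hη hc hs j => ?_⟩
  rw [← h.2 η hη hc hs j]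
  apply integral_congr_ae
  filter_upwards [huv] with x hx
  rw [hx]

lemma IsWeakGrad.mono {n : ℕ} {Ω Ω₁ : Set (Ev n)} {u : Ev n → ℝ} {D : Ev n → Ev n}
    (h : IsWeakGrad Ω u D) (hs : Ω₁ ⊆ Ω) : IsWeakGrad Ω₁ u D := by
  refine ⟨fun j => (h.1 j).mono_set hs, fun η hη hc hη1 j => ?_⟩
  have hd := (tsupport_fderiv_apply_subset η (EuclideanSpace.single j (1 : ℝ))).trans hη1
  rw [setIntegral_eq_integral_of_tsupport_subset hη1, setIntegral_eq_integral_of_tsupport_subset hd,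
    ← setIntegral_eq_integral_of_tsupport_subset (hη1.trans hs),
    ← setIntegral_eq_integral_of_tsupport_subset (hd.trans hs)]
  exact h.2 η hη hc (hη1.trans hs) j

lemma IntegrableOn.mul_fderiv {n : ℕ} {Ω : Set (Ev n)} {u : Ev n → ℝ} (hu : IntegrableOn u Ω)
    {η : Ev n → ℝ} (hη : ContDiff ℝ (⊤ : ℕ∞) η) (hc : HasCompactSupport η) (v : Ev n) :
    IntegrableOn (fun x => u x * fderiv ℝ η x v) Ω := by
  obtain ⟨B, hB⟩ := (continuous_fderiv_apply hη v).bounded_above_of_compact_support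
    (hc.fderiv_apply (𝕜 := ℝ) v)
  exact Integrable.mul_bdd hu (continuous_fderiv_apply hη v).aestronglyMeasurable
    (Eventually.of_forall hB)

lemma IsWeakGrad.add {n : ℕ} {Ω : Set (Ev n)} {u v : Ev n → ℝ} {D E : Ev n → Ev n}
    (h : IsWeakGrad Ω u D) (h' : IsWeakGrad Ω v E) (hu : IntegrableOn u Ω)
    (hv : IntegrableOn v Ω) : IsWeakGrad Ω (fun x => u x + v x) (fun x => D x + E x) := by
  refine ⟨fun j => (h.1 j).add (h'.1 j), fun η hη hc hs j => ?_⟩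
  have i1 := (integrable_mul_of_tsupport_subset (h.1 j) hη.continuous hc hs).integrableOn (s := Ω)
  have i2 := (integrable_mul_of_tsupport_subset (h'.1 j) hη.continuous hc hs).integrableOn (s := Ω)
  simp only [add_mul, PiLp.add_apply]
  rw [integral_add (IntegrableOn.mul_fderiv hu hη hc _) (IntegrableOn.mul_fderiv hv hη hc _),
    integral_add i1 i2, h.2 η hη hc hs j, h'.2 η hη hc hs j]
  ring

lemma IsWeakGrad.const_smul {n : ℕ} {Ω : Set (Ev n)} {u : Ev n → ℝ} {D : Ev n → Ev n}
    (h : IsWeakGrad Ω u D) (c : ℝ) : IsWeakGrad Ω (fun x => c * u x) (fun x => c • D x) := by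
  refine ⟨fun j => (h.1 j).smul c, fun η hη hc hs j => ?_⟩
  simp only [PiLp.smul_apply, smul_eq_mul, mul_assoc, integral_const_mul]
  rw [h.2 η hη hc hs j]
  ring

lemma isWeakGrad_zero {n : ℕ} (Ω : Set (Ev n)) : IsWeakGrad Ω (fun _ => 0) (fun _ => 0) := by
  refine ⟨fun j => ?_, fun η hη hc hs j => by simp⟩
  simpa using locallyIntegrableOn_zero

lemma IsWeakGrad.sum {n : ℕ} {ι : Type*} {Ω : Set (Ev n)} {u : ι → Ev n → ℝ}
    {D : ι → Ev n → Ev n} (F : Finset ι)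
    (h : ∀ i ∈ F, IsWeakGrad Ω (u i) (D i)) (hu : ∀ i ∈ F, IntegrableOn (u i) Ω) :
    IsWeakGrad Ω (fun x => ∑ i ∈ F, u i x) (fun x => ∑ i ∈ F, D i x) := by
  classical
  induction F using Finset.induction_on with
  | empty => simpa using isWeakGrad_zero Ω
  | insert a F ha ih =>
    simp only [Finset.sum_insert ha]
    refine (h a (by simp)).add (ih (fun i hi => h i (by simp [hi])) fun i hi => hu i (by simp [hi]))
      (hu a (by simp)) ?_
    exact integrable_finsetSum F fun i hi => hu i (by simp [hi])

lemma gradient_apply {n : ℕ} (u : Ev n → ℝ) (x : Ev n) (j : Fin n) :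
    gradient u x j = fderiv ℝ u x (EuclideanSpace.single j 1) := by
  have h := InnerProductSpace.toDual_symm_apply (𝕜 := ℝ) (x := EuclideanSpace.single j (1 : ℝ))
    (y := fderiv ℝ u x)
  rw [EuclideanSpace.inner_single_right] at h
  rw [gradient, ← h]
  simp

lemma norm_gradient {n : ℕ} (u : Ev n → ℝ) (x : Ev n) : ‖gradient u x‖ = ‖fderiv ℝ u x‖ := by
  simp [gradient]

/-- A Lipschitz function has its almost everywhere gradient as weak gradient. -/
lemma isWeakGrad_of_lipschitz {n : ℕ} {u : Ev n → ℝ} {L : ℝ≥0} (hu : LipschitzWith L u) :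
    IsWeakGrad Set.univ u (gradient u) := by
  have hdiff := hu.ae_differentiableAt (μ := volume)
  have hline : ∀ v : Ev n, ∀ᵐ x, lineDeriv ℝ u x v = fderiv ℝ u x v := fun v => by
    filter_upwards [hdiff] with x hx using hx.lineDeriv_eq_fderiv
  refine ⟨fun j => ?_, fun η hη hc hs j => ?_⟩
  · rw [locallyIntegrableOn_univ]
    have h := hu.locallyIntegrable_lineDeriv (μ := volume) (EuclideanSpace.single j (1 : ℝ))
    refine h.congr ?_
    filter_upwards [hline (EuclideanSpace.single j 1)] with x hx
    rw [hx, gradient_apply]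
  · obtain ⟨K, hK⟩ := hη.lipschitzWith_of_hasCompactSupport hc (by simp)
    have h := hu.integral_lineDeriv_mul_eq (μ := volume) hK hc (EuclideanSpace.single j (1 : ℝ))
    rw [Measure.restrict_univ]
    have e1 : ∫ x, gradient u x j * η x
        = ∫ x, lineDeriv ℝ u x (EuclideanSpace.single j 1) * η x := by
      apply integral_congr_ae
      filter_upwards [hline (EuclideanSpace.single j 1)] with x hx
      rw [hx, gradient_apply]
    have e2 : ∀ x, lineDeriv ℝ η x (-EuclideanSpace.single j 1) * u x
        = -(u x * fderiv ℝ η x (EuclideanSpace.single j 1)) := fun x => by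
      rw [((hη.differentiable (by simp)) x).lineDeriv_eq_fderiv, map_neg]
      ring
    rw [e1, h]
    simp_rw [e2]
    rw [integral_neg, neg_neg]

/-- Scheffé: nonnegative functions converging almost everywhere with constant integrals converge in
`L¹`. -/
lemma tendsto_integral_abs_sub {α : Type*} [MeasurableSpace α] {μ : Measure α} {f : ℕ → α → ℝ}
    {g : α → ℝ} (hf : ∀ k, Integrable (f k) μ) (hg : Integrable g μ) (hf0 : ∀ k x, 0 ≤ f k x)
    (hg0 : ∀ x, 0 ≤ g x) (hlim : ∀ᵐ x ∂μ, Tendsto (fun k => f k x) atTop (𝓝 (g x)))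
    (hint : ∀ k, ∫ x, f k x ∂μ = ∫ x, g x ∂μ) :
    Tendsto (fun k => ∫ x, |f k x - g x| ∂μ) atTop (𝓝 0) := by
  have h1 : ∀ k, ∫ x, |f k x - g x| ∂μ = 2 * ∫ x, max (g x - f k x) 0 ∂μ := by
    intro k
    have e : ∀ x, |f k x - g x| = (f k x - g x) + 2 * max (g x - f k x) 0 := by
      intro x
      rcases le_total (g x) (f k x) with h | h
      · rw [abs_of_nonneg (by linarith), max_eq_right (by linarith)]; ring
      · rw [abs_of_nonpos (by linarith), max_eq_left (by linarith)]; ring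
    simp_rw [e]
    have i1 : Integrable (fun x => max (g x - f k x) 0) μ := (hg.sub (hf k)).pos_part
    have i0 : Integrable (fun x => f k x - g x) μ := (hf k).sub hg
    rw [integral_add i0 (i1.const_mul 2), integral_sub (hf k) hg, hint k,
      integral_const_mul]
    ring
  simp_rw [h1]
  have h2 : Tendsto (fun k => ∫ x, max (g x - f k x) 0 ∂μ) atTop (𝓝 (∫ _x, (0 : ℝ) ∂μ)) := by
    refine tendsto_integral_of_dominated_convergence g
      (fun k => ((hg.sub (hf k)).pos_part).aestronglyMeasurable) hg ?_ ?_
    · intro k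
      refine Eventually.of_forall fun x => ?_
      rw [Real.norm_of_nonneg (le_max_right _ _)]
      exact max_le (by linarith [hf0 k x]) (hg0 x)
    · filter_upwards [hlim] with x hx
      have := ((tendsto_const_nhds (x := g x)).sub hx).max (tendsto_const_nhds (x := (0 : ℝ)))
      simpa using this
  simpa using h2.const_mul 2

/-- Convolution of a bump function with an integrable function. -/
def mollify {n : ℕ} (ρ : ContDiffBump (0 : Ev n)) (u : Ev n → ℝ) : Ev n → ℝ :=
  convolution (ρ.normed volume) u (ContinuousLinearMap.lsmul ℝ ℝ) volume

lemma mollify_apply {n : ℕ} (ρ : ContDiffBump (0 : Ev n)) (u : Ev n → ℝ) (x : Ev n) :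
    mollify ρ u x = ∫ t, u t * ρ.normed volume (x - t) := by
  rw [mollify, ← convolution_flip, convolution_def]
  simp [mul_comm]

lemma integrable_mollify {n : ℕ} (ρ : ContDiffBump (0 : Ev n)) {u : Ev n → ℝ}
    (hu : Integrable u) : Integrable (mollify ρ u) :=
  Integrable.integrable_convolution _ ρ.integrable_normed hu

lemma integral_mollify {n : ℕ} (ρ : ContDiffBump (0 : Ev n)) {u : Ev n → ℝ}
    (hu : Integrable u) : ∫ x, mollify ρ u x = ∫ x, u x := by
  rw [mollify, integral_convolution _ ρ.integrable_normed hu, ρ.integral_normed]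
  simp

lemma contDiff_mollify {n : ℕ} (ρ : ContDiffBump (0 : Ev n)) {u : Ev n → ℝ}
    (hu : Integrable u) : ContDiff ℝ (⊤ : ℕ∞) (mollify ρ u) :=
  ρ.hasCompactSupport_normed.contDiff_convolution_left _ ρ.contDiff_normed hu.locallyIntegrable

lemma integrable_mollify_integrand {n : ℕ} (ρ : ContDiffBump (0 : Ev n)) {u : Ev n → ℝ}
    (hu : Integrable u) (x : Ev n) : Integrable (fun t => u t * ρ.normed volume (x - t)) := by
  obtain ⟨B, hB⟩ := ρ.continuous_normed.bounded_above_of_compact_support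
    (ρ.hasCompactSupport_normed (μ := volume))
  exact hu.mul_bdd
    (ρ.continuous_normed.comp (continuous_const.sub continuous_id)).aestronglyMeasurable
    (Eventually.of_forall fun t => hB _)

lemma abs_mollify_le {n : ℕ} (ρ : ContDiffBump (0 : Ev n)) {u : Ev n → ℝ} {B : ℝ}
    (hu : ∀ᵐ x, |u x| ≤ B) (x : Ev n) : |mollify ρ u x| ≤ B := by
  rw [mollify_apply, ← Real.norm_eq_abs]
  have hi : Integrable (fun t => B * ρ.normed volume (x - t)) :=
    (ρ.integrable_normed.comp_sub_left x).const_mul B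
  refine (norm_integral_le_of_norm_le hi ?_).trans ?_
  · filter_upwards [hu] with t ht
    rw [norm_mul, Real.norm_eq_abs, Real.norm_of_nonneg (ρ.nonneg_normed _)]
    exact mul_le_mul_of_nonneg_right ht (ρ.nonneg_normed _)
  · rw [integral_const_mul, integral_sub_left_eq_self (fun t => ρ.normed volume t), ρ.integral_normed,
      mul_one]

/-- A sequence of bump functions whose supports shrink to the origin. -/
def bumpSeq {n : ℕ} (k : ℕ) : ContDiffBump (0 : Ev n) where
  rIn := 1 / (2 * ((k : ℝ) + 1))
  rOut := 1 / ((k : ℝ) + 1)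
  rIn_pos := by positivity
  rIn_lt_rOut := by
    apply one_div_lt_one_div_of_lt (by positivity)
    have : (0 : ℝ) ≤ k := k.cast_nonneg
    linarith

lemma tendsto_bumpSeq_rOut {n : ℕ} :
    Tendsto (fun k => (bumpSeq k : ContDiffBump (0 : Ev n)).rOut) atTop (𝓝 0) :=
  tendsto_one_div_add_atTop_nhds_zero_nat

lemma tendsto_mollify_bumpSeq {n : ℕ} {u : Ev n → ℝ} (hu : Integrable u) :
    ∀ᵐ x, Tendsto (fun k => mollify (bumpSeq k) u x) atTop (𝓝 (u x)) := by
  refine ContDiffBump.ae_convolution_tendsto_right_of_locallyIntegrable tendsto_bumpSeq_rOut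
    (K := 2) (Eventually.of_forall fun k => ?_) hu.locallyIntegrable
  simp only [bumpSeq]
  apply le_of_eq
  field_simp

lemma tendsto_integral_mollify_sub {n : ℕ} {u : Ev n → ℝ} (hu : Integrable u) :
    Tendsto (fun k => ∫ x, |mollify (bumpSeq k) u x - u x|) atTop (𝓝 0) := by
  have hnn : ∀ v : Ev n → ℝ, Integrable v → (∀ x, 0 ≤ v x) →
      Tendsto (fun k => ∫ x, |mollify (bumpSeq k) v x - v x|) atTop (𝓝 0) := by
    intro v hv hv0
    refine tendsto_integral_abs_sub (fun k => integrable_mollify _ hv) hv (fun k x => ?_) hv0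
      (tendsto_mollify_bumpSeq hv) (fun k => integral_mollify _ hv)
    rw [mollify_apply]
    exact integral_nonneg fun t => mul_nonneg (hv0 t) (ContDiffBump.nonneg_normed _ _)
  have h1 := hnn _ hu.pos_part fun x => le_max_right _ _
  have h2 := hnn _ hu.neg_part fun x => le_max_right _ _
  have h12 := h1.add h2
  rw [add_zero] at h12
  refine squeeze_zero (fun k => integral_nonneg fun x => abs_nonneg _) (fun k => ?_) h12
  have i1 := ((integrable_mollify (bumpSeq k) hu.pos_part).sub hu.pos_part).abs
  have i2 := ((integrable_mollify (bumpSeq k) hu.neg_part).sub hu.neg_part).abs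
  have i0 := ((integrable_mollify (bumpSeq k) hu).sub hu).abs
  have := integral_mono (μ := volume) i0 (i1.add i2) (fun x => ?_)
  · exact this.trans (integral_add i1 i2).le
  · have e : ∀ y : ℝ, max y 0 - max (-y) 0 = y := fun y => by
      rcases le_total y 0 with h | h
      · rw [max_eq_right h, max_eq_left (by linarith)]; ring
      · rw [max_eq_left h, max_eq_right (by linarith)]; ring
    have e1 : mollify (bumpSeq k) u x = mollify (bumpSeq k) (fun y => max (u y) 0) x
        - mollify (bumpSeq k) (fun y => max (-u y) 0) x := by
      simp only [mollify_apply]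
      rw [← integral_sub (integrable_mollify_integrand _ hu.pos_part x)
        (integrable_mollify_integrand _ hu.neg_part x)]
      congr 1
      ext t
      rw [← sub_mul, e]
    simp only [Pi.add_apply, Pi.sub_apply]
    rw [e1]
    calc _ = |(mollify (bumpSeq k) (fun y => max (u y) 0) x - max (u x) 0)
          - (mollify (bumpSeq k) (fun y => max (-u y) 0) x - max (-u x) 0)| := by
          congr 1; linarith [e (u x)]
      _ ≤ _ := abs_sub _ _

/-- Mollification commutes with weak differentiation away from the boundary. -/
lemma IsWeakGrad.fderiv_mollify {n : ℕ} {Ω : Set (Ev n)} (hΩ : IsOpen Ω) {u : Ev n → ℝ}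
    {D : Ev n → Ev n} (h : IsWeakGrad Ω u D) (hu : IntegrableOn u Ω)
    (ρ : ContDiffBump (0 : Ev n)) {x : Ev n} (hx : closedBall x ρ.rOut ⊆ Ω) (j : Fin n) :
    fderiv ℝ (mollify ρ (Ω.indicator u)) x (EuclideanSpace.single j 1)
      = mollify ρ (Ω.indicator fun y => D y j) x := by
  have hU : Integrable (Ω.indicator u) := hu.integrable_indicator hΩ.measurableSet
  have hr : ContDiff ℝ (⊤ : ℕ∞) (ρ.normed volume) := ρ.contDiff_normed
  have hrc : HasCompactSupport (ρ.normed volume) := ρ.hasCompactSupport_normed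
  have hd := hrc.hasFDerivAt_convolution_right (𝕜 := ℝ) (μ := volume)
    (ContinuousLinearMap.lsmul ℝ ℝ : ℝ →L[ℝ] ℝ →L[ℝ] ℝ).flip hU.locallyIntegrable
    (hr.of_le (by simp)) x
  rw [convolution_flip] at hd
  have hd' : HasFDerivAt (mollify ρ (Ω.indicator u)) _ x := hd
  rw [hd'.fderiv, convolution_precompR_apply _ hU.locallyIntegrable (hrc.fderiv (𝕜 := ℝ))
    (hr.continuous_fderiv (by simp)), convolution_def, mollify_apply]
  have hη : ContDiff ℝ (⊤ : ℕ∞) (fun t => ρ.normed volume (x - t)) :=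
    hr.comp (contDiff_const.sub contDiff_id)
  have hsupp : Function.support (fun t => ρ.normed volume (x - t)) ⊆ closedBall x ρ.rOut := by
    intro t ht
    have : x - t ∈ Function.support (ρ.normed volume) := ht
    rw [ρ.support_normed_eq] at this
    rw [mem_closedBall, dist_comm, dist_eq_norm]
    simpa using (mem_ball_zero_iff.1 this).le
  have hts : tsupport (fun t => ρ.normed volume (x - t)) ⊆ closedBall x ρ.rOut :=
    closure_minimal hsupp isClosed_closedBall
  have hc : HasCompactSupport (fun t => ρ.normed volume (x - t)) :=
    (isCompact_closedBall x ρ.rOut).of_isClosed_subset (isClosed_tsupport _) hts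
  have hw := h.2 _ hη hc (hts.trans hx) j
  have hf : ∀ t v, fderiv ℝ (fun t => ρ.normed volume (x - t)) t v
      = - fderiv ℝ (ρ.normed volume) (x - t) v := by
    intro t v
    have h1 : HasFDerivAt (fun t : Ev n => x - t) (-(ContinuousLinearMap.id ℝ (Ev n))) t :=
      (hasFDerivAt_id t).const_sub x
    have h2 := ((hr.differentiable (by simp)) (x - t)).hasFDerivAt
    have h3 := h2.comp t h1
    have h4 : fderiv ℝ (fun t => ρ.normed volume (x - t)) t = _ := h3.fderiv
    rw [h4]
    simp
  simp_rw [hf] at hw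
  have ind : ∀ (v w : Ev n → ℝ), ∫ t, Ω.indicator v t * w t = ∫ t in Ω, v t * w t := by
    intro v w
    rw [← integral_indicator hΩ.measurableSet]
    congr 1
    ext t
    by_cases ht : t ∈ Ω <;> simp [ht]
  rw [ind]
  have e : ∀ t, ((ContinuousLinearMap.lsmul ℝ ℝ : ℝ →L[ℝ] ℝ →L[ℝ] ℝ).flip (Ω.indicator u t))
      ((fderiv ℝ (ρ.normed volume) (x - t)) (EuclideanSpace.single j 1))
      = Ω.indicator u t * fderiv ℝ (ρ.normed volume) (x - t) (EuclideanSpace.single j 1) := by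
    intro t
    simp [mul_comm]
  simp_rw [e]
  rw [ind]
  simp only [mul_neg, integral_neg] at hw
  linarith

lemma setIntegral_comp_indicator_mul {n : ℕ} {Ω : Set (Ev n)} {F η : Ev n → ℝ} (v : Ev n → ℝ)
    (g : ℝ → ℝ) (hs : tsupport η ⊆ Ω) :
    ∫ x in Ω, g (v x) * F x * η x = ∫ x, g (Ω.indicator v x) * Ω.indicator F x * η x := by
  rw [setIntegral_eq_integral_of_tsupport_subset (F := fun x => g (v x) * F x) hs]
  congr 1
  ext x
  by_cases hx : x ∈ Ω
  · simp [hx]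
  · rw [image_eq_zero_of_notMem_tsupport (fun h => hx (hs h))]
    simp

/-- The chain rule for weak gradients. -/
lemma IsWeakGrad.integral_comp_mul_fderiv {n : ℕ} {Ω : Set (Ev n)} (hΩ : IsOpen Ω) {u : Ev n → ℝ}
    {D : Ev n → Ev n} (h : IsWeakGrad Ω u D) (hu : IntegrableOn u Ω)
    (hD : ∀ j, IntegrableOn (fun x => D x j) Ω) {ψ : ℝ → ℝ} (hψ : ContDiff ℝ (⊤ : ℕ∞) ψ)
    {B B' : ℝ} (hB : ∀ t, |ψ t| ≤ B) (hB' : ∀ t, |deriv ψ t| ≤ B') {η : Ev n → ℝ}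
    (hη : ContDiff ℝ (⊤ : ℕ∞) η) (hc : HasCompactSupport η) (hs : tsupport η ⊆ Ω) (j : Fin n) :
    ∫ x in Ω, ψ (u x) * fderiv ℝ η x (EuclideanSpace.single j 1)
      = - ∫ x in Ω, deriv ψ (u x) * D x j * η x := by
  set e : Ev n := EuclideanSpace.single j 1 with he
  set U := Ω.indicator u with hUdef
  set G := Ω.indicator (fun y => D y j) with hGdef
  have hU : Integrable U := hu.integrable_indicator hΩ.measurableSet
  have hG : Integrable G := (hD j).integrable_indicator hΩ.measurableSet
  have hη' := continuous_fderiv_apply hη e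
  have hηc : HasCompactSupport (fun x => fderiv ℝ η x e) := hc.fderiv_apply (𝕜 := ℝ) e
  have hψ' : Continuous (deriv ψ) := hψ.continuous_deriv (by simp)
  obtain ⟨M, hM⟩ := hη.continuous.bounded_above_of_compact_support hc
  have hB'0 : 0 ≤ B' := (abs_nonneg _).trans (hB' 0)
  have hlim := tendsto_mollify_bumpSeq hU
  have hUk : ∀ k, ContDiff ℝ (⊤ : ℕ∞) (mollify (bumpSeq k) U) := fun k => contDiff_mollify _ hU
  have hGk : ∀ k, ContDiff ℝ (⊤ : ℕ∞) (mollify (bumpSeq k) G) := fun k => contDiff_mollify _ hG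
  have key : ∀ᶠ k in atTop, ∫ x, ψ (mollify (bumpSeq k) U x) * fderiv ℝ η x e
      = - ∫ x, deriv ψ (mollify (bumpSeq k) U x) * mollify (bumpSeq k) G x * η x := by
    obtain ⟨δ, hδ, hδs⟩ := hc.isCompact.exists_cthickening_subset_open hΩ hs
    filter_upwards [(tendsto_order.1 (tendsto_bumpSeq_rOut (n := n))).2 δ hδ] with k hk
    have hfd : ∀ x, fderiv ℝ (fun y => ψ (mollify (bumpSeq k) U y)) x e
        = deriv ψ (mollify (bumpSeq k) U x) * fderiv ℝ (mollify (bumpSeq k) U) x e := by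
      intro x
      have h1 := ((hψ.differentiable (by simp)) (mollify (bumpSeq k) U x)).hasDerivAt
      have h2 := (((hUk k).differentiable (by simp)) x).hasFDerivAt
      have h3 := h1.comp_hasFDerivAt x h2
      have h4 : fderiv ℝ (fun y => ψ (mollify (bumpSeq k) U y)) x = _ := h3.fderiv
      rw [h4]
      simp
    have hcd : ContDiff ℝ (⊤ : ℕ∞) (fun y => ψ (mollify (bumpSeq k) U y)) := hψ.comp (hUk k)
    have ibp := integral_mul_fderiv_eq_neg_fderiv_mul_of_integrable (μ := volume) (𝕜 := ℝ)
      (f := fun y => ψ (mollify (bumpSeq k) U y)) (g := η) (v := e)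
      (((continuous_fderiv_apply hcd e).mul hη.continuous).integrable_of_hasCompactSupport
        hc.mul_left)
      ((hcd.continuous.mul hη').integrable_of_hasCompactSupport hηc.mul_left)
      ((hcd.continuous.mul hη.continuous).integrable_of_hasCompactSupport hc.mul_left)
      (fun x _ => hcd.differentiable (by simp) x) (fun x _ => hη.differentiable (by simp) x)
    rw [ibp]
    congr 2
    ext x
    by_cases hx : x ∈ tsupport η
    · rw [hfd, h.fderiv_mollify hΩ hu (bumpSeq k) ?_ j]
      exact ((closedBall_subset_closedBall hk.le).trans (closedBall_subset_cthickening hx δ)).trans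
        hδs
    · rw [image_eq_zero_of_notMem_tsupport hx, mul_zero, mul_zero]
  have lim1 : Tendsto (fun k => ∫ x, ψ (mollify (bumpSeq k) U x) * fderiv ℝ η x e) atTop
      (𝓝 (∫ x, ψ (U x) * fderiv ℝ η x e)) := by
    refine tendsto_integral_of_dominated_convergence (fun x => B * ‖fderiv ℝ η x e‖)
      (fun k => ((hψ.continuous.comp (hUk k).continuous).mul hη').aestronglyMeasurable)
      ((hη'.integrable_of_hasCompactSupport hηc).norm.const_mul B) (fun k => ?_) ?_
    · refine Eventually.of_forall fun x => ?_
      rw [norm_mul]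
      exact mul_le_mul_of_nonneg_right (hB _) (norm_nonneg _)
    · filter_upwards [hlim] with x hx
      exact ((hψ.continuous.tendsto _).comp hx).mul_const _
  have lim2 : Tendsto (fun k => ∫ x, deriv ψ (mollify (bumpSeq k) U x) * G x * η x) atTop
      (𝓝 (∫ x, deriv ψ (U x) * G x * η x)) := by
    refine tendsto_integral_of_dominated_convergence (fun x => B' * ‖G x‖ * M)
      (fun k => (((hψ'.comp (hUk k).continuous).aestronglyMeasurable).mul
        hG.aestronglyMeasurable).mul hη.continuous.aestronglyMeasurable)
      ((hG.norm.const_mul B').mul_const M) (fun k => ?_) ?_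
    · refine Eventually.of_forall fun x => ?_
      rw [norm_mul, norm_mul]
      exact mul_le_mul (mul_le_mul_of_nonneg_right (hB' _) (norm_nonneg _)) (hM x) (norm_nonneg _)
        (by positivity)
    · filter_upwards [hlim] with x hx
      exact (((hψ'.tendsto _).comp hx).mul_const _).mul_const _
  have lim3 : Tendsto (fun k => ∫ x, deriv ψ (mollify (bumpSeq k) U x) *
      (mollify (bumpSeq k) G x - G x) * η x) atTop (𝓝 0) := by
    have h0 := (tendsto_integral_mollify_sub hG).const_mul (B' * M)
    rw [mul_zero] at h0
    refine squeeze_zero_norm (fun k => ?_) h0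
    rw [← integral_const_mul]
    refine norm_integral_le_of_norm_le
      (((integrable_mollify (bumpSeq k) hG).sub hG).abs.const_mul _) (Eventually.of_forall fun x => ?_)
    rw [norm_mul, norm_mul, Real.norm_eq_abs, Real.norm_eq_abs, mul_assoc, mul_assoc,
      mul_comm M]
    exact mul_le_mul (hB' _) (mul_le_mul_of_nonneg_left (hM x) (abs_nonneg _)) (by positivity) hB'0
  have lim4 : Tendsto (fun k => ∫ x, deriv ψ (mollify (bumpSeq k) U x) * mollify (bumpSeq k) G x
      * η x) atTop (𝓝 (∫ x, deriv ψ (U x) * G x * η x)) := by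
    have := lim2.add lim3
    rw [add_zero] at this
    refine this.congr fun k => ?_
    have m1 : AEStronglyMeasurable (fun x => deriv ψ (mollify (bumpSeq k) U x)) volume :=
      (hψ'.comp (hUk k).continuous).aestronglyMeasurable
    have bd : ∀ F : Ev n → ℝ, Integrable F →
        Integrable (fun x => deriv ψ (mollify (bumpSeq k) U x) * F x * η x) := by
      intro F hF
      exact (hF.bdd_mul m1 (Eventually.of_forall fun x => hB' _)).mul_bdd
        hη.continuous.aestronglyMeasurable (Eventually.of_forall hM)
    have i2 : Integrable (fun x => deriv ψ (mollify (bumpSeq k) U x) *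
        (mollify (bumpSeq k) G x - G x) * η x) :=
      bd _ ((integrable_mollify (bumpSeq k) hG).sub hG)
    rw [← integral_add (bd _ hG) i2]
    congr 1
    ext x
    ring
  have fin := tendsto_nhds_unique (lim1.congr' key) lim4.neg
  rw [setIntegral_comp_indicator_mul u (deriv ψ) hs, ← fin]
  have hts : tsupport (fun x => fderiv ℝ η x e) ⊆ Ω := (tsupport_fderiv_apply_subset η e).trans hs
  rw [setIntegral_eq_integral_of_tsupport_subset (F := fun x => ψ (u x)) hts]
  congr 1
  ext x
  by_cases hx : x ∈ Ω
  · simp [hUdef, hx]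
  · rw [image_eq_zero_of_notMem_tsupport (f := fun x => fderiv ℝ η x e) (fun h => hx (hts h)),
      mul_zero, mul_zero]

/-- The weak gradient vanishes almost everywhere on the zero set of the function. -/
lemma IsWeakGrad.ae_eq_zero {n : ℕ} {Ω : Set (Ev n)} (hΩ : IsOpen Ω) {u : Ev n → ℝ}
    {D : Ev n → Ev n} (h : IsWeakGrad Ω u D) (hu : IntegrableOn u Ω)
    (hD : ∀ j, IntegrableOn (fun x => D x j) Ω) :
    ∀ᵐ x ∂(volume.restrict Ω), u x = 0 → D x = 0 := by
  have hm : ∀ k : ℕ, (0 : ℝ) < k + 1 := fun k => by positivity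
  let ψ : ℕ → ℝ → ℝ := fun k t => (1 / ((k : ℝ) + 1)) * Real.arctan ((k + 1) * t)
  have hder : ∀ k t, deriv (ψ k) t = 1 / (1 + ((k + 1) * t) ^ 2) := by
    intro k t
    have h1 : HasDerivAt (fun t : ℝ => ((k : ℝ) + 1) * t) ((k + 1) * 1) t :=
      (hasDerivAt_id t).const_mul _
    have h2 := (h1.arctan).const_mul (1 / ((k : ℝ) + 1))
    have h3 : deriv (ψ k) t = _ := h2.deriv
    rw [h3]
    have := hm k
    field_simp
  have hcd : ∀ k, ContDiff ℝ (⊤ : ℕ∞) (ψ k) := fun k =>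
    contDiff_const.mul (Real.contDiff_arctan.comp (contDiff_const.mul contDiff_id))
  have hB : ∀ k t, |ψ k t| ≤ (1 / ((k : ℝ) + 1)) * (Real.pi / 2) := by
    intro k t
    rw [abs_mul, abs_of_nonneg (by positivity : (0 : ℝ) ≤ 1 / ((k : ℝ) + 1))]
    apply mul_le_mul_of_nonneg_left _ (by positivity)
    exact abs_le.2 ⟨(Real.neg_pi_div_two_lt_arctan _).le, (Real.arctan_lt_pi_div_two _).le⟩
  have hB' : ∀ k t, |deriv (ψ k) t| ≤ 1 := by
    intro k t
    rw [hder, abs_of_nonneg (by positivity), div_le_one (by positivity)]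
    nlinarith [sq_nonneg (((k : ℝ) + 1) * t)]
  have hlim : ∀ t : ℝ, Tendsto (fun k => deriv (ψ k) t) atTop (𝓝 (if t = 0 then 1 else 0)) := by
    intro t
    simp_rw [hder]
    split_ifs with ht
    · simp [ht]
    · have h1 : Tendsto (fun k : ℕ => (k : ℝ) + 1) atTop atTop :=
        tendsto_atTop_add_const_right _ _ tendsto_natCast_atTop_atTop
      have h2 : Tendsto (fun k : ℕ => 1 + (((k : ℝ) + 1) * t) ^ 2) atTop atTop := by
        apply tendsto_atTop_add_const_left
        simp_rw [mul_pow]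
        exact ((tendsto_pow_atTop two_ne_zero).comp h1).atTop_mul_const (by positivity)
      simpa [Function.comp_def] using tendsto_inv_atTop_zero.comp h2
  have key : ∀ j : Fin n, ∀ᵐ x, x ∈ Ω → (if u x = 0 then 1 else 0) * D x j = 0 := by
    intro j
    have hint : IntegrableOn (fun x => (if u x = 0 then 1 else 0) * D x j) Ω := by
      refine Integrable.mono (hD j) ?_ (Eventually.of_forall fun x => ?_)
      · refine aestronglyMeasurable_of_tendsto_ae atTop
          (f := fun k x => deriv (ψ k) (u x) * D x j) (fun k => ?_) (Eventually.of_forall fun x => ?_)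
        · exact (((hcd k).continuous_deriv (by simp)).comp_aestronglyMeasurable
            hu.aestronglyMeasurable).mul (hD j).aestronglyMeasurable
        · exact (hlim (u x)).mul_const _
      · split_ifs <;> simp
    refine hΩ.ae_eq_zero_of_integral_contDiff_smul_eq_zero (μ := volume)
      hint.locallyIntegrableOn fun η hη hc hs => ?_
    obtain ⟨M, hM⟩ := hη.continuous.bounded_above_of_compact_support hc
    have hη' := continuous_fderiv_apply hη (EuclideanSpace.single j (1 : ℝ))
    have hηc : HasCompactSupport (fun x => fderiv ℝ η x (EuclideanSpace.single j (1 : ℝ))) :=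
      hc.fderiv_apply (𝕜 := ℝ) _
    have hηi := hη'.integrable_of_hasCompactSupport (μ := volume) hηc
    have eqk := fun k => h.integral_comp_mul_fderiv hΩ hu hD (hcd k) (hB k) (hB' k) hη hc hs j
    have lim1 : Tendsto (fun k => ∫ x in Ω, deriv (ψ k) (u x) * D x j * η x) atTop
        (𝓝 (∫ x in Ω, (if u x = 0 then 1 else 0) * D x j * η x)) := by
      refine tendsto_integral_of_dominated_convergence (fun x => 1 * ‖D x j‖ * M)
        (fun k => ((((hcd k).continuous_deriv (by simp)).comp_aestronglyMeasurable
            hu.aestronglyMeasurable).mul (hD j).aestronglyMeasurable).mul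
            hη.continuous.aestronglyMeasurable)
        (((hD j).norm.const_mul 1).mul_const M) (fun k => ?_) ?_
      · refine Eventually.of_forall fun x => ?_
        rw [norm_mul, norm_mul]
        exact mul_le_mul (mul_le_mul_of_nonneg_right (hB' _ _) (norm_nonneg _)) (hM x)
          (norm_nonneg _) (by positivity)
      · exact Eventually.of_forall fun x => ((hlim (u x)).mul_const _).mul_const _
    have lim2 : Tendsto (fun k => ∫ x in Ω, ψ k (u x) *
        fderiv ℝ η x (EuclideanSpace.single j 1)) atTop (𝓝 0) := by
      have h0 : Tendsto (fun k : ℕ => (1 / ((k : ℝ) + 1)) * ((Real.pi / 2) *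
          ∫ x in Ω, ‖fderiv ℝ η x (EuclideanSpace.single j 1)‖)) atTop (𝓝 0) := by
        simpa using tendsto_one_div_add_atTop_nhds_zero_nat.mul_const ((Real.pi / 2) *
          ∫ x in Ω, ‖fderiv ℝ η x (EuclideanSpace.single j 1)‖)
      refine squeeze_zero_norm (fun k => ?_) h0
      rw [← mul_assoc, ← integral_const_mul]
      refine norm_integral_le_of_norm_le (hηi.norm.integrableOn.const_mul _)
        (Eventually.of_forall fun x => ?_)
      rw [norm_mul]
      exact mul_le_mul_of_nonneg_right (hB k _) (norm_nonneg _)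
    simp_rw [eqk] at lim2
    have := tendsto_nhds_unique lim1.neg lim2
    rw [neg_eq_zero, setIntegral_eq_integral_of_tsupport_subset
      (F := fun x => (if u x = 0 then 1 else 0) * D x j) hs] at this
    refine Eq.trans ?_ this
    congr 1
    ext x
    rw [smul_eq_mul, mul_comm]
  rw [ae_restrict_iff' hΩ.measurableSet]
  filter_upwards [ae_all_iff.2 key] with x hx hxΩ hux
  ext j
  simpa [hux] using hx j hxΩ

/-- A function whose weak gradient is bounded by `M` is almost everywhere `M`-Lipschitz. -/
lemma IsWeakGrad.exists_lipschitzOnWith {n : ℕ} {u : Ev n → ℝ} {D : Ev n → Ev n}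
    (h : IsWeakGrad Set.univ u D) (hu : Integrable u) (hD : ∀ j, Integrable (fun x => D x j))
    {M : ℝ≥0} (hM : ∀ᵐ x, ‖D x‖ ≤ M) :
    ∃ S : Set (Ev n), (∀ᵐ x, x ∈ S) ∧ LipschitzOnWith M u S := by
  refine ⟨{x | Tendsto (fun k => mollify (bumpSeq k) u x) atTop (𝓝 (u x))},
    tendsto_mollify_bumpSeq hu, ?_⟩
  have hL : ∀ k, LipschitzWith M (mollify (bumpSeq k) u) := by
    intro k
    refine lipschitzWith_of_nnnorm_fderiv_le ((contDiff_mollify _ hu).differentiable (by simp))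
      fun x => ?_
    rw [← NNReal.coe_le_coe, coe_nnnorm]
    refine ContinuousLinearMap.opNorm_le_bound _ M.2 fun v => ?_
    have hj : ∀ j, fderiv ℝ (mollify (bumpSeq k) u) x (EuclideanSpace.single j 1)
        = mollify (bumpSeq k) (fun y => D y j) x := by
      intro j
      simpa using h.fderiv_mollify isOpen_univ hu.integrableOn (bumpSeq k) (subset_univ _) j
        (x := x)
    have hv : v = ∑ j, v j • (EuclideanSpace.single j (1 : ℝ) : Ev n) := by
      ext i
      simp [Finset.sum_apply, Pi.single_apply]
    have hval : fderiv ℝ (mollify (bumpSeq k) u) x v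
        = mollify (bumpSeq k) (fun y => ∑ j, v j * D y j) x := by
      conv_lhs => rw [hv]
      rw [map_sum]
      simp_rw [map_smul, hj, mollify_apply, Finset.sum_mul]
      rw [integral_finsetSum]
      · refine Finset.sum_congr rfl fun j _ => ?_
        simp_rw [mul_assoc]
        rw [integral_const_mul, smul_eq_mul]
      · intro j _
        exact integrable_mollify_integrand _ ((hD j).const_mul _) x
    rw [hval, Real.norm_eq_abs]
    refine abs_mollify_le _ ?_ x
    filter_upwards [hM] with y hy
    have e : ∑ j, v j * D y j = inner ℝ (D y) v := by
      simp [PiLp.inner_apply]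
    rw [e]
    exact (abs_real_inner_le_norm _ _).trans (mul_le_mul_of_nonneg_right hy (norm_nonneg _))
  refine LipschitzOnWith.of_dist_le_mul fun x hx y hy => ?_
  refine le_of_tendsto (hx.dist hy) (Eventually.of_forall fun k => (hL k).dist_le_mul x y)


lemma norm_gradient_le_of_abs_sub_le {n : ℕ} {w h : Ev n → ℝ} {x : Ev n} {a : ℝ} (ha : 0 ≤ a)
    (hh : DifferentiableAt ℝ h x) (hwh : ∀ y, |w y - w x| ≤ |h y - h x| + a * ‖y - x‖) :
    ‖gradient w x‖ ≤ ‖gradient h x‖ + a := by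
  by_cases hw : DifferentiableAt ℝ w x
  · rw [norm_gradient, norm_gradient]
    refine le_of_forall_pos_le_add fun ε hε => ?_
    refine hw.hasFDerivAt.le_of_lip' (by positivity) ?_
    have ho := hh.hasFDerivAt.isLittleO.def hε
    filter_upwards [ho] with y hy
    have h1 : h y - h x = (h y - h x - fderiv ℝ h x (y - x)) + fderiv ℝ h x (y - x) := by ring
    have h2 : |h y - h x| ≤ ‖h y - h x - fderiv ℝ h x (y - x)‖ + ‖fderiv ℝ h x (y - x)‖ := by
      rw [h1]
      simpa using norm_add_le (h y - h x - fderiv ℝ h x (y - x)) (fderiv ℝ h x (y - x))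
    calc ‖w y - w x‖ ≤ |h y - h x| + a * ‖y - x‖ := hwh y
      _ ≤ (ε * ‖y - x‖ + ‖fderiv ℝ h x‖ * ‖y - x‖) + a * ‖y - x‖ := by
          gcongr
          exact h2.trans (add_le_add hy ((fderiv ℝ h x).le_opNorm _))
      _ = _ := by ring
  · rw [gradient_eq_zero_of_not_differentiableAt hw, norm_zero]
    positivity

lemma measurable_gradient {n : ℕ} (u : Ev n → ℝ) : Measurable (gradient u) :=
  (LinearIsometryEquiv.continuous _).measurable.comp (measurable_fderiv ℝ u)

lemma norm_gradient_le_of_lipschitz {n : ℕ} {u : Ev n → ℝ} {L : ℝ≥0} (hu : LipschitzWith L u)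
    (x : Ev n) : ‖gradient u x‖ ≤ L := by
  rw [norm_gradient]
  exact norm_fderiv_le_of_lipschitz ℝ hu

lemma gradient_eq_zero_of_eqOn_zero {n : ℕ} {u : Ev n → ℝ} {O : Set (Ev n)} (hO : IsOpen O)
    (hu : ∀ x ∈ O, u x = 0) {x : Ev n} (hx : x ∈ O) : gradient u x = 0 := by
  have h1 : u =ᶠ[𝓝 x] fun _ => (0 : ℝ) := by
    filter_upwards [hO.mem_nhds hx] with y hy using hu y hy
  rw [h1.gradient_eq, gradient_fun_const]

lemma hasCompactSupport_of_eq_zero_off_closedBall {n : ℕ} {h : Ev n → ℝ} {R : ℝ}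
    (h0 : ∀ x ∉ closedBall (0 : Ev n) R, h x = 0) : HasCompactSupport h :=
  HasCompactSupport.intro (isCompact_closedBall 0 R) h0

lemma integrable_norm_gradient {n : ℕ} {h : Ev n → ℝ} {R : ℝ} {L : ℝ≥0} (hL : LipschitzWith L h)
    (h0 : ∀ x ∉ closedBall (0 : Ev n) R, h x = 0) : Integrable (fun x => ‖gradient h x‖) := by
  have hb : IntegrableOn (fun x => ‖gradient h x‖) (closedBall (0 : Ev n) R) :=
    Measure.integrableOn_of_bounded (M := (L : ℝ)) measure_closedBall_lt_top.ne
      (measurable_gradient h).norm.aestronglyMeasurable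
      (Eventually.of_forall fun x => by simpa using norm_gradient_le_of_lipschitz hL x)
  rwa [integrableOn_iff_integrable_of_support_subset] at hb
  intro x hx
  by_contra hxb
  apply hx
  simp [gradient_eq_zero_of_eqOn_zero isClosed_closedBall.isOpen_compl h0 hxb]

/-- The Poincaré inequality in `L¹` for Lipschitz functions supported in a ball. -/
lemma integral_abs_le_mul_integral_norm_gradient {n : ℕ} (hn : 1 ≤ n) {h : Ev n → ℝ} {R : ℝ}
    (hR : 0 ≤ R) {L : ℝ≥0} (hL : LipschitzWith L h)
    (h0 : ∀ x ∉ closedBall (0 : Ev n) R, h x = 0) :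
    ∫ x, |h x| ≤ R * ∫ x, ‖gradient h x‖ := by
  let i : Fin n := ⟨0, hn⟩
  let e : Ev n := EuclideanSpace.single i 1
  have hcoord : LipschitzWith 1 (fun x : Ev n => x i) := by
    refine LipschitzWith.of_dist_le_mul fun x y => ?_
    simpa [Real.dist_eq, dist_eq_norm] using PiLp.norm_apply_le (x - y) i
  have habs : LipschitzWith L (fun x => |h x|) := by
    refine LipschitzWith.of_dist_le_mul fun x y => ?_
    exact (abs_abs_sub_abs_le _ _).trans (hL.dist_le_mul x y)
  have h0' : ∀ x ∉ closedBall (0 : Ev n) R, |h x| = 0 := fun x hx => by rw [h0 x hx, abs_zero]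
  have hld : ∀ x : Ev n, lineDeriv ℝ (fun x : Ev n => x i) x e = 1 := by
    intro x
    have h1 : HasFDerivAt (𝕜 := ℝ) (fun x : Ev n => x i) (EuclideanSpace.proj i : Ev n →L[ℝ] ℝ) x :=
      (EuclideanSpace.proj i : Ev n →L[ℝ] ℝ).hasFDerivAt
    rw [h1.differentiableAt.lineDeriv_eq_fderiv, h1.fderiv]
    simp [e]
  have key := hcoord.integral_lineDeriv_mul_eq (μ := volume) habs
    (hasCompactSupport_of_eq_zero_off_closedBall h0') e
  simp only [hld, one_mul] at key
  rw [key, ← integral_const_mul]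
  refine (Real.le_norm_self _).trans ?_
  refine norm_integral_le_of_norm_le ((integrable_norm_gradient hL h0).const_mul R) ?_
  filter_upwards [hL.ae_differentiableAt (μ := volume), habs.ae_differentiableAt (μ := volume)]
    with x hx hx'
  rw [hx'.lineDeriv_eq_fderiv, norm_mul, mul_comm]
  by_cases hxb : x ∈ closedBall (0 : Ev n) R
  · have h1 : ‖x i‖ ≤ R := (PiLp.norm_apply_le x i).trans (by simpa using hxb)
    refine mul_le_mul h1 ?_ (norm_nonneg _) hR
    refine ((fderiv ℝ (fun x => |h x|) x).le_opNorm (-e)).trans ?_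
    rw [← norm_gradient]
    simpa [e] using norm_gradient_le_of_abs_sub_le le_rfl hx fun y => by
      simpa using abs_abs_sub_abs_le (h y) (h x)
  · have h1 := gradient_eq_zero_of_eqOn_zero isClosed_closedBall.isOpen_compl h0' hxb
    have h2 : fderiv ℝ (fun x => |h x|) x = 0 := by
      rw [← norm_eq_zero, ← norm_gradient, h1, norm_zero]
    rw [h2]
    simp only [_root_.zero_apply, norm_zero, mul_zero]
    positivity

lemma eLpNorm_one_le_mul_eLpNorm_gradient {n : ℕ} (hn : 1 ≤ n) {p : ℝ≥0∞} (hp : 1 ≤ p) (R : ℝ)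
    (hR : 0 ≤ R) : ∃ K : ℝ≥0∞, K ≠ ⊤ ∧ ∀ (h : Ev n → ℝ) (L : ℝ≥0), LipschitzWith L h →
      (∀ x ∉ closedBall (0 : Ev n) R, h x = 0) →
      eLpNorm h 1 volume ≤ K * eLpNorm (gradient h) p volume := by
  set V := volume (closedBall (0 : Ev n) R) with hV
  have hVt : V ≠ ⊤ := measure_closedBall_lt_top.ne
  refine ⟨ENNReal.ofReal R * V ^ (1 / (1 : ℝ≥0∞).toReal - 1 / p.toReal), ?_, ?_⟩
  · refine ENNReal.mul_ne_top ENNReal.ofReal_ne_top (ENNReal.rpow_ne_top_of_nonneg ?_ hVt)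
    rcases eq_or_ne p ⊤ with rfl | hpt
    · simp
    · have : 1 ≤ p.toReal := by simpa using ENNReal.toReal_mono hpt hp
      rw [ENNReal.toReal_one, div_one, sub_nonneg, div_le_one (by positivity)]
      exact this
  · intro h L hL h0
    have hi : Integrable h :=
      hL.continuous.integrable_of_hasCompactSupport (hasCompactSupport_of_eq_zero_off_closedBall h0)
    have h1 : eLpNorm h 1 volume ≤ ENNReal.ofReal R * eLpNorm (gradient h) 1 volume := by
      have hg := integrable_norm_gradient hL h0
      have hg' : Integrable (gradient h) :=
        (integrable_norm_iff (measurable_gradient h).aestronglyMeasurable).1 hg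
      rw [eLpNorm_one_eq_lintegral_enorm, eLpNorm_one_eq_lintegral_enorm,
        ← ofReal_integral_norm_eq_lintegral_enorm hi, ← ofReal_integral_norm_eq_lintegral_enorm hg',
        ← ENNReal.ofReal_mul hR]
      exact ENNReal.ofReal_le_ofReal (integral_abs_le_mul_integral_norm_gradient hn hR hL h0)
    have h2 : eLpNorm (gradient h) 1 volume
        = eLpNorm (gradient h) 1 (volume.restrict (closedBall (0 : Ev n) R)) := by
      rw [eLpNorm_restrict_eq_of_support_subset]
      intro x hx
      by_contra hxb
      exact hx (gradient_eq_zero_of_eqOn_zero isClosed_closedBall.isOpen_compl h0 hxb)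
    have h3 := eLpNorm_le_eLpNorm_mul_rpow_measure_univ
      (μ := volume.restrict (closedBall (0 : Ev n) R)) hp
      (measurable_gradient h).aestronglyMeasurable
    rw [← h2, Measure.restrict_apply_univ, ← hV] at h3
    refine h1.trans ?_
    rw [mul_assoc]
    gcongr
    refine h3.trans ?_
    rw [mul_comm]
    gcongr
    exact Measure.restrict_le_self

lemma MemL1pZero.ae_eq_zero {n : ℕ} {p : ℝ≥0∞} {A : Set (Ev n)} {f : Ev n → ℝ} {Df : Ev n → Ev n}
    (h : MemL1pZero p A f Df) (hp : 1 ≤ p) (hA : MeasurableSet A) :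
    ∀ᵐ x, x ∉ A → Df x = 0 := by
  have hm : AEStronglyMeasurable Df volume := by
    simpa using h.1.aestronglyMeasurable
  have h0 : eLpNorm (Aᶜ.indicator Df) p volume = 0 := by
    by_contra hne
    obtain ⟨ε, hε, hlt⟩ : ∃ ε : ℝ, 0 < ε ∧ ENNReal.ofReal ε ≤ eLpNorm (Aᶜ.indicator Df) p volume := by
      rcases eq_or_ne (eLpNorm (Aᶜ.indicator Df) p volume) ⊤ with ht | ht
      · exact ⟨1, one_pos, by simp [ht]⟩
      · exact ⟨_, ENNReal.toReal_pos hne ht, (ENNReal.ofReal_toReal ht).le⟩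
    obtain ⟨g, -, -, hgs, hg⟩ := h.2.2.2 ε hε
    refine (hlt.trans (eLpNorm_mono fun x => ?_)).not_gt hg
    · by_cases hx : x ∈ A
      · simp [hx]
      · have : gradient g x = 0 :=
          gradient_eq_zero_of_eqOn_zero (isClosed_tsupport g).isOpen_compl
            (fun y hy => image_eq_zero_of_notMem_tsupport hy) (fun hx' => hx (hgs hx'))
        simp [hx, this]
  rw [eLpNorm_eq_zero_iff (hm.indicator hA.compl) (by positivity)] at h0
  filter_upwards [h0] with x hx hxA
  simpa [hxA] using hx

/-- A member of the class is almost everywhere equal to a globally Lipschitz function. -/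
lemma MemL1pZero.exists_lipschitzWith {n : ℕ} {p : ℝ≥0∞} {A : Set (Ev n)} {f : Ev n → ℝ}
    {Df : Ev n → Ev n} {L : ℝ≥0} (h : MemL1pZero p A f Df) (hp : 1 ≤ p) (hA : IsOpen A)
    (hb : Bornology.IsBounded A) (hL : LipschitzOnWith L f A) :
    ∃ f' : Ev n → ℝ, LipschitzWith L f' ∧ f' =ᵐ[volume] f ∧ EqOn f' f A ∧
      (∀ x ∉ closure A, f' x = 0) ∧ Df =ᵐ[volume] gradient f' := by
  obtain ⟨F, hF, hFf⟩ := hL.extend_real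
  have hD0 := h.ae_eq_zero hp hA.measurableSet
  have hDF : Df =ᵐ[volume.restrict A] gradient F := by
    refine (h.1.mono (subset_univ A)).ae_eq hA (((isWeakGrad_of_lipschitz hF).mono
      (subset_univ A)).congr ?_)
    filter_upwards [ae_restrict_mem hA.measurableSet] with x hx using (hFf hx).symm
  have hDL : ∀ᵐ x, ‖Df x‖ ≤ A.indicator (fun _ => (L : ℝ)) x := by
    filter_upwards [hD0, (ae_restrict_iff' hA.measurableSet).1 hDF] with x h1 h2
    by_cases hx : x ∈ A
    · rw [h2 hx]; simpa [hx] using norm_gradient_le_of_lipschitz hF x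
    · rw [h1 hx]; simp [hx]
  have hfi : Integrable f := by
    have h1 : IntegrableOn F A :=
      (hF.continuous.continuousOn.integrableOn_compact hb.isCompact_closure).mono_set subset_closure
    have h2 := h1.integrable_indicator hA.measurableSet
    refine h2.congr (Eventually.of_forall fun x => ?_)
    by_cases hx : x ∈ A
    · simp [hx, hFf hx]
    · simp [hx, h.2.1 x hx]
  have hLi : Integrable (A.indicator (fun _ => (L : ℝ))) :=
    (integrableOn_const (hb.measure_lt_top.ne)).integrable_indicator hA.measurableSet
  have hm : AEStronglyMeasurable Df volume := by
    simpa using h.1.aestronglyMeasurable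
  have hDi : ∀ j, Integrable (fun x => Df x j) := fun j => by
    refine hLi.mono' ?_ ?_
    · exact (EuclideanSpace.proj j : Ev n →L[ℝ] ℝ).continuous.comp_aestronglyMeasurable hm
    · filter_upwards [hDL] with x hx using (PiLp.norm_apply_le _ j).trans hx
  obtain ⟨S, hS, hSL⟩ := h.1.exists_lipschitzOnWith hfi hDi (M := L) <| by
    filter_upwards [hDL] with x hx
    exact hx.trans (indicator_le_self' (fun _ _ => L.2) x)
  obtain ⟨f', hf', hf'S⟩ := hSL.extend_real
  have hae : f' =ᵐ[volume] f := by
    filter_upwards [hS] with x hx using (hf'S hx).symm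
  have hon : EqOn f' f A := by
    refine Measure.eqOn_open_of_ae_eq (ae_restrict_of_ae hae) hA hf'.continuous.continuousOn
      hL.continuousOn
  refine ⟨f', hf', hae, hon, ?_, ?_⟩
  · have : EqOn f' (fun _ => 0) (closure A)ᶜ := by
      refine Measure.eqOn_open_of_ae_eq (μ := volume) ?_ isClosed_closure.isOpen_compl
        hf'.continuous.continuousOn continuousOn_const
      filter_upwards [ae_restrict_of_ae hae, ae_restrict_mem isClosed_closure.isOpen_compl.measurableSet]
        with x hx hxA
      rw [hx, h.2.1 x (fun hx' => hxA (subset_closure hx'))]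
    exact fun x hx => this hx
  · have := h.1.ae_eq isOpen_univ ((isWeakGrad_of_lipschitz hf').congr (ae_restrict_of_ae hae))
    simpa using this

/-- Weak gradients are closed under distributional convergence of the functions and `L_q`
convergence of the gradients. -/
lemma isWeakGrad_of_tendsto {n : ℕ} {Ω : Set (Ev n)} {q : ℝ≥0∞} (hq : 1 ≤ q)
    {u : ℕ → Ev n → ℝ} {D : ℕ → Ev n → Ev n} {v : Ev n → ℝ} {E : Ev n → Ev n}
    (hE : ∀ j, LocallyIntegrableOn (fun x => E x j) Ω) (h : ∀ k, IsWeakGrad Ω (u k) (D k))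
    (hu : ∀ η : Ev n → ℝ, ContDiff ℝ (⊤ : ℕ∞) η → HasCompactSupport η → tsupport η ⊆ Ω →
      ∀ j : Fin n, Tendsto (fun k => ∫ x in Ω, u k x * fderiv ℝ η x (EuclideanSpace.single j 1))
        atTop (𝓝 (∫ x in Ω, v x * fderiv ℝ η x (EuclideanSpace.single j 1))))
    (hD : Tendsto (fun k => eLpNorm (fun x => D k x - E x) q (volume.restrict Ω)) atTop (𝓝 0)) :
    IsWeakGrad Ω v E := by
  refine ⟨hE, fun η hη hc hs j => ?_⟩
  have h1 := hu η hη hc hs j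
  have h2 : Tendsto (fun k => ∫ x in Ω, D k x j * η x) atTop (𝓝 (∫ x in Ω, E x j * η x)) := by
    have i1 := fun k => integrable_mul_of_tsupport_subset ((h k).1 j) hη.continuous hc hs
    have i2 := integrable_mul_of_tsupport_subset (hE j) hη.continuous hc hs
    obtain ⟨M, hM⟩ := hη.continuous.bounded_above_of_compact_support hc
    set T := tsupport η with hT
    set V := volume T ^ (1 / (1 : ℝ≥0∞).toReal - 1 / q.toReal) with hV
    have hVt : V ≠ ⊤ := by
      refine ENNReal.rpow_ne_top_of_nonneg ?_ hc.isCompact.measure_lt_top.ne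
      rcases eq_or_ne q ⊤ with rfl | hpt
      · simp
      · have : 1 ≤ q.toReal := by simpa using ENNReal.toReal_mono hpt hq
        rw [ENNReal.toReal_one, div_one, sub_nonneg, div_le_one (by positivity)]
        exact this
    rw [tendsto_iff_edist_tendsto_0]
    have hz : Tendsto (fun k => eLpNorm (fun x => D k x - E x) q (volume.restrict Ω) * V *
        ENNReal.ofReal M) atTop (𝓝 0) := by
      have := ENNReal.Tendsto.mul_const (b := V) hD (Or.inr hVt)
      have := ENNReal.Tendsto.mul_const (b := ENNReal.ofReal M) this (Or.inr ENNReal.ofReal_ne_top)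
      simpa using this
    refine tendsto_of_tendsto_of_tendsto_of_le_of_le tendsto_const_nhds hz (fun _ => zero_le) ?_
    intro k
    have hm : AEStronglyMeasurable (fun x => D k x j - E x j) (volume.restrict T) :=
      (((h k).1 j).integrableOn_compact_subset hs hc).aestronglyMeasurable.sub
        ((hE j).integrableOn_compact_subset hs hc).aestronglyMeasurable
    have e1 : edist (∫ x in Ω, D k x j * η x) (∫ x in Ω, E x j * η x)
        = ‖∫ x in T, (D k x j - E x j) * η x‖ₑ := by
      rw [setIntegral_eq_integral_of_tsupport_subset (F := fun x => D k x j) hs,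
        setIntegral_eq_integral_of_tsupport_subset (F := fun x => E x j) hs, edist_eq_enorm_sub,
        ← integral_sub (i1 k) i2, setIntegral_eq_integral_of_tsupport_subset
          (F := fun x => D k x j - E x j) subset_rfl]
      simp_rw [sub_mul]
    beta_reduce
    rw [e1]
    calc ‖∫ x in T, (D k x j - E x j) * η x‖ₑ ≤ ∫⁻ x in T, ‖(D k x j - E x j) * η x‖ₑ :=
          enorm_integral_le_lintegral_enorm _
      _ ≤ ∫⁻ x in T, ‖D k x j - E x j‖ₑ * ENNReal.ofReal M := by
          refine lintegral_mono fun x => ?_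
          rw [enorm_mul]
          gcongr
          rw [← ofReal_norm]
          exact ENNReal.ofReal_le_ofReal (hM x)
      _ = eLpNorm (fun x => D k x j - E x j) 1 (volume.restrict T) * ENNReal.ofReal M := by
          rw [lintegral_mul_const' _ _ ENNReal.ofReal_ne_top, eLpNorm_one_eq_lintegral_enorm]
      _ ≤ eLpNorm (fun x => D k x - E x) q (volume.restrict Ω) * V * ENNReal.ofReal M := by
          gcongr
          refine (eLpNorm_le_eLpNorm_mul_rpow_measure_univ hq hm).trans ?_
          rw [Measure.restrict_apply_univ]
          gcongr
          refine (eLpNorm_mono fun x => ?_).trans (eLpNorm_mono_measure _ (Measure.restrict_mono hs le_rfl))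
          exact PiLp.norm_apply_le (D k x - E x) j
  refine tendsto_nhds_unique h1 ?_
  simp_rw [(h _).2 η hη hc hs j]
  exact h2.neg

lemma isWeakGrad_zero_of_tendsto {n : ℕ} {Ω : Set (Ev n)} {q : ℝ≥0∞} (hq : 1 ≤ q)
    {u : ℕ → Ev n → ℝ} {D : ℕ → Ev n → Ev n} {v : Ev n → ℝ} {M : ℝ}
    (h : ∀ k, IsWeakGrad Ω (u k) (D k)) (hm : ∀ k, AEStronglyMeasurable (u k) (volume.restrict Ω))
    (hM : ∀ k x, |u k x| ≤ M) (hu : ∀ x, Tendsto (fun k => u k x) atTop (𝓝 (v x)))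
    (hD : Tendsto (fun k => eLpNorm (D k) q (volume.restrict Ω)) atTop (𝓝 0)) :
    IsWeakGrad Ω v (fun _ => 0) := by
  refine isWeakGrad_of_tendsto hq (fun j => (isWeakGrad_zero Ω).1 j) h (fun η hη hc hs j => ?_)
    (by simpa using hD)
  have hη' := continuous_fderiv_apply hη (EuclideanSpace.single j (1 : ℝ))
  have hηi := hη'.integrable_of_hasCompactSupport (μ := volume) (hc.fderiv_apply (𝕜 := ℝ) _)
  refine tendsto_integral_of_dominated_convergence
    (fun x => M * ‖fderiv ℝ η x (EuclideanSpace.single j 1)‖)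
    (fun k => (hm k).mul hη'.aestronglyMeasurable) (hηi.norm.integrableOn.const_mul M)
    (fun k => Eventually.of_forall fun x => ?_) (Eventually.of_forall fun x => (hu x).mul_const _)
  rw [norm_mul]
  exact mul_le_mul_of_nonneg_right (hM k x) (norm_nonneg _)

lemma gradient_sub_ae_eq {n : ℕ} {f g : Ev n → ℝ} {Df : Ev n → Ev n} {L : ℝ≥0}
    (hf : LipschitzWith L f) (hD : Df =ᵐ[volume] gradient f) (hg : ContDiff ℝ (⊤ : ℕ∞) g) :
    gradient (fun x => f x - g x) =ᵐ[volume] fun x => Df x - gradient g x := by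
  filter_upwards [hD, hf.ae_differentiableAt (μ := volume)] with x hx hdx
  rw [hx, gradient, gradient, gradient, fderiv_fun_sub hdx (hg.differentiable (by simp) x), map_sub]

lemma MemL1pZero.exists_contDiff_sub {n : ℕ} {p : ℝ≥0∞} {A : Set (Ev n)} {f f' : Ev n → ℝ}
    {Df : Ev n → Ev n} {L : ℝ≥0} (h : MemL1pZero p A f Df) (hf' : LipschitzWith L f')
    (hD : Df =ᵐ[volume] gradient f') {ε : ℝ} (hε : 0 < ε) :
    ∃ g : Ev n → ℝ, ContDiff ℝ (⊤ : ℕ∞) g ∧ HasCompactSupport g ∧ tsupport g ⊆ A ∧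
      (∃ L' : ℝ≥0, LipschitzWith L' (fun x => f' x - g x)) ∧
      eLpNorm (gradient (fun x => f' x - g x)) p volume < ENNReal.ofReal ε := by
  obtain ⟨g, hg, hgc, hgs, hgε⟩ := h.2.2.2 ε hε
  obtain ⟨Lg, hLg⟩ := hg.lipschitzWith_of_hasCompactSupport hgc (by simp)
  refine ⟨g, hg, hgc, hgs, ⟨L + Lg, hf'.sub hLg⟩, ?_⟩
  exact lt_of_eq_of_lt (eLpNorm_congr_ae (gradient_sub_ae_eq hf' hD hg)) hgε

lemma eLpNorm_le_of_abs_le {n : ℕ} {c h : Ev n → ℝ} {M : ℝ} {p : ℝ≥0∞} (hp : 1 ≤ p) (hpt : p ≠ ⊤)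
    (hcM : ∀ x, |c x| ≤ M) (hch : ∀ x, |c x| ≤ |h x|) :
    eLpNorm c p volume
      ≤ (ENNReal.ofReal M ^ (p.toReal - 1) * eLpNorm h 1 volume) ^ (1 / p.toReal) := by
  have hp0 : p ≠ 0 := by positivity
  have hp1 : 1 ≤ p.toReal := by simpa using ENNReal.toReal_mono hpt hp
  rw [eLpNorm_eq_lintegral_rpow_enorm_toReal hp0 hpt, eLpNorm_one_eq_lintegral_enorm,
    ← lintegral_const_mul' _ _ (ENNReal.rpow_ne_top_of_nonneg (by linarith) ENNReal.ofReal_ne_top)]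
  gcongr with x
  have h1 : ‖c x‖ₑ ≤ ENNReal.ofReal M := by
    rw [← ofReal_norm]; exact ENNReal.ofReal_le_ofReal (hcM x)
  have h2 : ‖c x‖ₑ ≤ ‖h x‖ₑ := by
    rw [← ofReal_norm, ← ofReal_norm]; exact ENNReal.ofReal_le_ofReal (hch x)
  calc ‖c x‖ₑ ^ p.toReal = ‖c x‖ₑ ^ (p.toReal - 1) * ‖c x‖ₑ ^ (1 : ℝ) := by
        rw [← ENNReal.rpow_add_of_nonneg _ _ (by linarith) (by norm_num)]; simp
    _ ≤ ENNReal.ofReal M ^ (p.toReal - 1) * ‖h x‖ₑ := by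
        rw [ENNReal.rpow_one]
        gcongr

/-- Cutting off and truncating a Lipschitz function. -/
lemma exists_cutoff {n : ℕ} {h : Ev n → ℝ} {L : ℝ≥0} (hL : LipschitzWith L h) {M : ℝ} (hM : 0 ≤ M)
    {p : ℝ≥0∞} (hp : 1 ≤ p) (hpt : p ≠ ⊤) (K : Set (Ev n)) {δ : ℝ} (hδ : 0 < δ) :
    ∃ (r : Ev n → ℝ) (L' : ℝ≥0), LipschitzWith L' r ∧ (∀ x, |r x| ≤ M) ∧
      (∀ x ∈ K, |h x| ≤ M → r x = h x) ∧ (∀ x ∉ thickening δ K, r x = 0) ∧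
      eLpNorm (gradient r) p volume ≤ eLpNorm (gradient h) p volume + ENNReal.ofReal δ⁻¹ *
        (ENNReal.ofReal M ^ (p.toReal - 1) * eLpNorm h 1 volume) ^ (1 / p.toReal) := by
  let η : Ev n → ℝ := fun x => (thickenedIndicator hδ K x : ℝ)
  let c : Ev n → ℝ := fun x => max (min (h x) M) (-M)
  have hη0 : ∀ x, 0 ≤ η x := fun x => NNReal.coe_nonneg _
  have hη1 : ∀ x, η x ≤ 1 := fun x => by exact_mod_cast thickenedIndicator_le_one hδ K x
  have hηL : ∀ x y, |η y - η x| ≤ δ⁻¹ * ‖y - x‖ := by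
    intro x y
    have := (lipschitzWith_thickenedIndicator hδ K).dist_le_mul y x
    rw [dist_eq_norm y x, NNReal.coe_inv, Real.coe_toNNReal _ hδ.le] at this
    exact this
  have hcM : ∀ x, |c x| ≤ M := fun x =>
    abs_le.2 ⟨le_max_right _ _, max_le (min_le_right _ _) (by linarith)⟩
  have hcL : ∀ x y, |c y - c x| ≤ |h y - h x| := by
    intro x y
    refine (abs_max_sub_max_le_abs _ _ _).trans ((abs_min_sub_min_le_max _ _ _ _).trans ?_)
    simp
  have hch : ∀ x, |c x| ≤ |h x| := by
    intro x
    rcases le_total 0 (h x) with h0 | h0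
    · have : 0 ≤ c x := le_max_of_le_left (le_min h0 hM)
      rw [abs_of_nonneg this, abs_of_nonneg h0]
      exact max_le (min_le_left _ _) (by linarith)
    · have h1 : c x ≤ 0 := max_le ((min_le_left _ _).trans h0) (by linarith)
      rw [abs_of_nonpos h1, abs_of_nonpos h0, neg_le_neg_iff]
      refine le_max_of_le_left (le_min le_rfl (by linarith))
  have hinc : ∀ x y, |η y * c y - η x * c x| ≤ |h y - h x| + (δ⁻¹ * |c x|) * ‖y - x‖ := by
    intro x y
    have e : η y * c y - η x * c x = η y * (c y - c x) + c x * (η y - η x) := by ring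
    rw [e]
    refine (abs_add_le _ _).trans ?_
    rw [abs_mul, abs_mul, abs_of_nonneg (hη0 y)]
    have h1 : η y * |c y - c x| ≤ 1 * |h y - h x| :=
      mul_le_mul (hη1 y) (hcL x y) (abs_nonneg _) zero_le_one
    have h2 := mul_le_mul_of_nonneg_left (hηL x y) (abs_nonneg (c x))
    nlinarith
  have hcc : Continuous c := (hL.continuous.min continuous_const).max continuous_const
  refine ⟨fun x => η x * c x, L + (δ⁻¹ * M).toNNReal, ?_, ?_, ?_, ?_, ?_⟩
  · refine LipschitzWith.of_dist_le_mul fun y x => ?_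
    refine (hinc x y).trans ?_
    have h1 : |h y - h x| ≤ L * ‖y - x‖ := by
      simpa [Real.dist_eq, dist_eq_norm] using hL.dist_le_mul y x
    have h2 : (δ⁻¹ * |c x|) * ‖y - x‖ ≤ (δ⁻¹ * M) * ‖y - x‖ := by
      gcongr
      exact hcM x
    rw [dist_eq_norm, NNReal.coe_add, Real.coe_toNNReal _ (by positivity)]
    linarith
  · intro x
    rw [abs_mul, abs_of_nonneg (hη0 x)]
    exact (mul_le_mul (hη1 x) (hcM x) (abs_nonneg _) zero_le_one).trans (one_mul M).le
  · intro x hx hxM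
    have h1 : η x = 1 := by
      simp only [η]
      rw [thickenedIndicator_one hδ K hx, NNReal.coe_one]
    have h2 : c x = h x := by
      simp only [c]
      rw [min_eq_left (abs_le.1 hxM).2, max_eq_left (abs_le.1 hxM).1]
    beta_reduce
    rw [h1, h2, one_mul]
  · intro x hx
    have h1 : η x = 0 := by
      simp only [η]
      rw [thickenedIndicator_zero hδ K hx, NNReal.coe_zero]
    beta_reduce
    rw [h1, zero_mul]
  · calc eLpNorm (gradient fun x => η x * c x) p volume
        ≤ eLpNorm ((fun x => ‖gradient h x‖) + δ⁻¹ • fun x => |c x|) p volume := by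
          refine eLpNorm_mono_ae ?_
          filter_upwards [hL.ae_differentiableAt (μ := volume)] with x hx
          refine (norm_gradient_le_of_abs_sub_le (by positivity) hx (hinc x)).trans ?_
          exact Real.le_norm_self _
      _ ≤ eLpNorm (fun x => ‖gradient h x‖) p volume + eLpNorm (δ⁻¹ • fun x => |c x|) p volume :=
          eLpNorm_add_le (measurable_gradient h).norm.aestronglyMeasurable
            (hcc.abs.aestronglyMeasurable.const_smul _) hp
      _ ≤ _ := by
          rw [eLpNorm_norm, eLpNorm_const_smul, ← ofReal_norm, Real.norm_of_nonneg (by positivity)]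
          gcongr
          refine (eLpNorm_mono (g := c) fun x => by simp).trans ?_
          exact eLpNorm_le_of_abs_le hp hpt hcM hch

lemma CompOpBoundedLip.exists_isWeakGrad {n : ℕ} {Ω Ω' : Set (Ev n)} {φ : Ev n → Ev n}
    {p q C : ℝ≥0∞} (hcomp : CompOpBoundedLip Ω Ω' φ p q C) {r : Ev n → ℝ} {L : ℝ≥0}
    (hr : LipschitzWith L r) (hfin : eLpNorm (gradient r) p volume < ⊤) :
    ∃ D : Ev n → Ev n, IsWeakGrad Ω (r ∘ φ) D ∧
      eLpNorm D q (volume.restrict Ω) ≤ C * eLpNorm (gradient r) p (volume.restrict Ω') :=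
  hcomp r (gradient r) L (hr.lipschitzOnWith) ((isWeakGrad_of_lipschitz hr).mono (subset_univ _))
    ((eLpNorm_restrict_le _ _ _ _).trans_lt hfin)

lemma integrableOn_comp_of_bounded {n : ℕ} {Ω : Set (Ev n)} (hΩ : Bornology.IsBounded Ω)
    {φ : Ev n → Ev n} (hφ : AEMeasurable φ (volume.restrict Ω)) {w : Ev n → ℝ} (hw : Measurable w)
    {M : ℝ} (hM : ∀ x, |w x| ≤ M) : IntegrableOn (w ∘ φ) Ω := by
  have : IsFiniteMeasure (volume.restrict Ω) := isFiniteMeasure_restrict.2 hΩ.measure_lt_top.ne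
  exact Integrable.of_bound (hw.comp_aemeasurable hφ).aestronglyMeasurable M
    (Eventually.of_forall fun x => hM (φ x))

lemma isWeakGrad_indicator_comp_of_isClosed {n : ℕ} (hn : 1 ≤ n) {Ω Ω' : Set (Ev n)}
    {φ : Ev n → Ev n} {p q C : ℝ≥0∞} (hφ : AEMeasurable φ (volume.restrict Ω)) (hp : 1 ≤ p)
    (hpt : p ≠ ⊤) (hq : 1 ≤ q) (hC : C < ⊤) (hcomp : CompOpBoundedLip Ω Ω' φ p q C)
    {A : Set (Ev n)} (hb : Bornology.IsBounded A) {f f' : Ev n → ℝ} {Df : Ev n → Ev n} {L : ℝ≥0}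
    (h : MemL1pZero p A f Df) (hf' : LipschitzWith L f') (hD : Df =ᵐ[volume] gradient f')
    (h0 : ∀ x ∉ closure A, f' x = 0) {M : ℝ} (hM : ∀ x, |f' x| ≤ M) {K : Set (Ev n)}
    (hK : IsClosed K) (hKA : Disjoint K A) :
    IsWeakGrad Ω (K.indicator f' ∘ φ) (fun _ => 0) := by
  have hM0 : 0 ≤ M := (abs_nonneg _).trans (hM 0)
  have hp1 : 1 ≤ p.toReal := by simpa using ENNReal.toReal_mono hpt hp
  obtain ⟨R₀, hR₀⟩ := hb.closure.subset_closedBall (0 : Ev n)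
  obtain ⟨P, hP, hPoin⟩ := eLpNorm_one_le_mul_eLpNorm_gradient hn hp (max R₀ 0) (le_max_right _ _)
  have hball : ∀ x ∉ closedBall (0 : Ev n) (max R₀ 0), x ∉ closure A := fun x hx hxA =>
    hx (closedBall_subset_closedBall (le_max_left _ _) (hR₀ hxA))
  have hδ : ∀ m : ℕ, (0 : ℝ) < 1 / (m + 1) := fun m => by positivity
  have hex : ∀ m : ℕ, ∃ (r : Ev n → ℝ) (L' : ℝ≥0), LipschitzWith L' r ∧ (∀ x, |r x| ≤ M) ∧
      (∀ x ∈ K, r x = f' x) ∧ (∀ x ∉ thickening (1 / ((m : ℝ) + 1)) K, r x = 0) ∧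
      eLpNorm (gradient r) p volume ≤ ENNReal.ofReal (1 / (m + 1)) := by
    intro m
    set δ : ℝ := 1 / (m + 1) with hδdef
    have hlim : Tendsto (fun k : ℕ => ENNReal.ofReal (1 / ((k : ℝ) + 1)) + ENNReal.ofReal δ⁻¹ *
        (ENNReal.ofReal M ^ (p.toReal - 1) * (P * ENNReal.ofReal (1 / ((k : ℝ) + 1))))
          ^ (1 / p.toReal)) atTop (𝓝 0) := by
      have e0 : Tendsto (fun k : ℕ => ENNReal.ofReal (1 / ((k : ℝ) + 1))) atTop (𝓝 0) := by
        simpa using ENNReal.tendsto_ofReal (tendsto_one_div_add_atTop_nhds_zero_nat (𝕜 := ℝ))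
      have e1 := ENNReal.Tendsto.const_mul (a := P) e0 (Or.inr hP)
      have e2 := ENNReal.Tendsto.const_mul (a := ENNReal.ofReal M ^ (p.toReal - 1)) e1
        (Or.inr (ENNReal.rpow_ne_top_of_nonneg (by linarith) ENNReal.ofReal_ne_top))
      have e3 := e2.ennrpow_const (1 / p.toReal)
      have e4 := ENNReal.Tendsto.const_mul (a := ENNReal.ofReal δ⁻¹) e3
        (Or.inr ENNReal.ofReal_ne_top)
      have e5 := e0.add e4
      have hpos : 0 < 1 / p.toReal := by positivity
      simpa [ENNReal.zero_rpow_of_pos, hpos, (by linarith : 0 < p.toReal)] using e5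
    obtain ⟨k, hk⟩ := ((tendsto_order.1 hlim).2 (ENNReal.ofReal δ)
      (ENNReal.ofReal_pos.2 (hδ m))).exists
    obtain ⟨g, hg, hgc, hgs, ⟨L', hL'⟩, hgε⟩ := h.exists_contDiff_sub hf' hD (hδ k)
    have hg0 : ∀ x ∉ A, g x = 0 := fun x hx => image_eq_zero_of_notMem_tsupport fun hx' => hx (hgs hx')
    obtain ⟨r, L'', hr, hrM, hrK, hr0, hrg⟩ := exists_cutoff hL' hM0 hp hpt K (hδ m)
    have hfK : ∀ x ∈ K, f' x - g x = f' x := fun x hx => by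
      rw [hg0 x (fun hxA => (Set.disjoint_left.1 hKA) hx hxA), sub_zero]
    refine ⟨r, L'', hr, hrM, fun x hx => ?_, hr0, hrg.trans (le_trans ?_ hk.le)⟩
    · rw [hrK x hx (by rw [hfK x hx]; exact hM x), hfK x hx]
    · have := hPoin _ L' hL' (fun x hx => by
        rw [h0 x (hball x hx), hg0 x (fun hxA => hball x hx (subset_closure hxA)), sub_zero])
      gcongr
      exact this.trans (by gcongr)
  choose r L' hr hrM hrK hr0 hrg using hex
  choose D hDw hDle using fun m =>
    hcomp.exists_isWeakGrad (hr m) ((hrg m).trans_lt ENNReal.ofReal_lt_top)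
  refine isWeakGrad_zero_of_tendsto hq hDw
    (fun k => ((hr k).continuous.measurable.comp_aemeasurable hφ).aestronglyMeasurable)
    (M := M) (fun k x => hrM k (φ x)) (fun x => ?_) ?_
  · by_cases hx : φ x ∈ K
    · simp [hx, hrK]
    · obtain ⟨ε, hε, hεK⟩ := Metric.isOpen_iff.1 hK.isOpen_compl (φ x) hx
      have hev : ∀ᶠ k : ℕ in atTop, 1 / ((k : ℝ) + 1) < ε :=
        (tendsto_order.1 (tendsto_one_div_add_atTop_nhds_zero_nat (𝕜 := ℝ))).2 ε hε
      refine tendsto_const_nhds.congr' ?_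
      filter_upwards [hev] with k hk
      have : φ x ∉ thickening (1 / ((k : ℝ) + 1)) K := by
        rw [mem_thickening_iff]
        rintro ⟨z, hz, hxz⟩
        exact hεK (by rw [mem_ball, dist_comm]; exact hxz.trans hk) hz
      simp [hx, hr0 k (φ x) this]
  · have e0 : Tendsto (fun k : ℕ => ENNReal.ofReal (1 / ((k : ℝ) + 1))) atTop (𝓝 0) := by
      simpa using ENNReal.tendsto_ofReal (tendsto_one_div_add_atTop_nhds_zero_nat (𝕜 := ℝ))
    have e1 := ENNReal.Tendsto.const_mul (a := C) e0 (Or.inr hC.ne)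
    rw [mul_zero] at e1
    refine tendsto_of_tendsto_of_tendsto_of_le_of_le tendsto_const_nhds e1 (fun _ => zero_le)
      fun k => (hDle k).trans ?_
    exact mul_le_mul_right ((eLpNorm_restrict_le _ _ _ _).trans (hrg k)) _

/-- For `p = ∞` the Lipschitz representative vanishes off `A`. -/
lemma MemL1pZero.eq_zero_of_top {n : ℕ} (hn : 1 ≤ n) {A : Set (Ev n)} (hb : Bornology.IsBounded A)
    {f f' : Ev n → ℝ} {Df : Ev n → Ev n} {L : ℝ≥0} (h : MemL1pZero ⊤ A f Df)
    (hf' : LipschitzWith L f') (hD : Df =ᵐ[volume] gradient f') (h0 : ∀ x ∉ closure A, f' x = 0)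
    {x : Ev n} (hx : x ∉ A) : f' x = 0 := by
  obtain ⟨R₀, hR₀⟩ := hb.closure.subset_closedBall (0 : Ev n)
  set R := max R₀ 0 with hR
  have hRpos : 0 ≤ R := le_max_right _ _
  have hball : ∀ x ∉ closedBall (0 : Ev n) R, x ∉ closure A := fun x hx hxA =>
    hx (closedBall_subset_closedBall (le_max_left _ _) (hR₀ hxA))
  let z : Ev n := EuclideanSpace.single ⟨0, hn⟩ (R + 1)
  have hz : z ∉ closedBall (0 : Ev n) R := by
    simp only [z, mem_closedBall, dist_zero_right, PiLp.norm_single, Real.norm_eq_abs]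
    rw [abs_of_nonneg (by linarith)]
    linarith
  have key : ∀ ε : ℝ, 0 < ε → |f' x| ≤ ε * dist x z := by
    intro ε hε
    obtain ⟨g, hg, hgc, hgs, ⟨L', hL'⟩, hgε⟩ := h.exists_contDiff_sub hf' hD hε
    have hg0 : ∀ x ∉ A, g x = 0 := fun x hx => image_eq_zero_of_notMem_tsupport fun hx' => hx (hgs hx')
    set w : Ev n → ℝ := fun x => f' x - g x with hw
    have hw0 : ∀ x ∉ closedBall (0 : Ev n) R, w x = 0 := fun x hx => by
      simp only [hw]
      rw [h0 x (hball x hx), hg0 x (fun hxA => hball x hx (subset_closure hxA)), sub_zero]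
    have hwi : Integrable w := hL'.continuous.integrable_of_hasCompactSupport
      (hasCompactSupport_of_eq_zero_off_closedBall hw0)
    have hgn := integrable_norm_gradient hL' hw0
    have hgi : ∀ j, Integrable (fun x => gradient w x j) := fun j =>
      hgn.mono' ((EuclideanSpace.proj j : Ev n →L[ℝ] ℝ).continuous.comp_aestronglyMeasurable
        (measurable_gradient w).aestronglyMeasurable)
        (Eventually.of_forall fun x => PiLp.norm_apply_le _ j)
    have hbd : ∀ᵐ x, ‖gradient w x‖ ≤ (⟨ε, hε.le⟩ : ℝ≥0) := by
      have := (ae_le_eLpNormEssSup (f := gradient w) (μ := volume))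
      rw [eLpNorm_exponent_top] at hgε
      filter_upwards [this] with y hy
      have h1 := hy.trans hgε.le
      rw [← ofReal_norm] at h1
      exact (ENNReal.ofReal_le_ofReal_iff hε.le).1 h1
    obtain ⟨S, hS, hSL⟩ := (isWeakGrad_of_lipschitz hL').exists_lipschitzOnWith hwi hgi hbd
    obtain ⟨w', hw', hw'S⟩ := hSL.extend_real
    have hww : w = w' := by
      refine Continuous.ae_eq_iff_eq volume hL'.continuous hw'.continuous |>.1 ?_
      filter_upwards [hS] with y hy using hw'S hy
    rw [← hww] at hw'
    have h2 := hw'.dist_le_mul x z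
    have h3 : w x = f' x := by simp only [hw]; rw [hg0 x hx, sub_zero]
    rw [hw0 z hz, h3, Real.dist_eq, sub_zero] at h2
    exact h2
  by_contra hne
  have hpos : 0 < |f' x| := abs_pos.2 hne
  have hd : 0 < dist x z + 1 := by positivity
  have := key (|f' x| / (dist x z + 1)) (by positivity)
  rw [div_mul_eq_mul_div, le_div_iff₀ hd] at this
  nlinarith

/-- The compositions of `φ` with a member of the class and with its Lipschitz representative
share their weak gradients. -/
lemma MemL1pZero.isWeakGrad_comp {n : ℕ} (hn : 1 ≤ n) {Ω Ω' : Set (Ev n)}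
    (hΩb : Bornology.IsBounded Ω) {φ : Ev n → Ev n} {p q C : ℝ≥0∞}
    (hφ : AEMeasurable φ (volume.restrict Ω)) (hp : 1 ≤ p) (hq : 1 ≤ q) (hC : C < ⊤)
    (hcomp : CompOpBoundedLip Ω Ω' φ p q C) {A : Set (Ev n)} (hA : IsOpen A)
    (hb : Bornology.IsBounded A) {f f' : Ev n → ℝ} {Df : Ev n → Ev n} {L : ℝ≥0}
    (h : MemL1pZero p A f Df) (hf' : LipschitzWith L f') (hD : Df =ᵐ[volume] gradient f')
    (hff' : EqOn f' f A) (h0 : ∀ x ∉ closure A, f' x = 0) {D : Ev n → Ev n}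
    (hw : IsWeakGrad Ω (f' ∘ φ) D) : IsWeakGrad Ω (f ∘ φ) D := by
  have hcs : HasCompactSupport f' := HasCompactSupport.intro hb.isCompact_closure h0
  obtain ⟨M, hM⟩ := hf'.continuous.bounded_above_of_compact_support hcs
  have hw0 : IsWeakGrad Ω (Aᶜ.indicator f' ∘ φ) (fun _ => 0) := by
    rcases eq_or_ne p ⊤ with rfl | hpt
    · have : Aᶜ.indicator f' = fun _ => 0 := by
        ext x
        by_cases hx : x ∈ A
        · simp [hx]
        · simp [hx, h.eq_zero_of_top hn hb hf' hD h0 hx]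
      rw [this]
      exact isWeakGrad_zero Ω
    · let K : ℕ → Set (Ev n) := fun m => Aᶜ ∩ {x | 1 / ((m : ℝ) + 1) ≤ |f' x|}
      have hK : ∀ m, IsClosed (K m) := fun m =>
        hA.isClosed_compl.inter (isClosed_le continuous_const hf'.continuous.abs)
      refine isWeakGrad_zero_of_tendsto hq (M := M) (fun m =>
        isWeakGrad_indicator_comp_of_isClosed hn hφ hp hpt hq hC hcomp hb h hf' hD h0 hM (hK m) ?_)
        (fun m => ?_) (fun m x => ?_) (fun x => ?_) (by simp)
      · exact Set.disjoint_left.2 fun x hx hxA => hx.1 hxA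
      · exact ((hf'.continuous.measurable.indicator (hK m).measurableSet).comp_aemeasurable
          hφ).aestronglyMeasurable
      · exact (norm_indicator_le_norm_self f' (φ x)).trans (hM _)
      · by_cases hx : φ x ∈ A
        · simp [K, hx]
        · by_cases hfx : f' (φ x) = 0
          · have hz : ∀ s : Set (Ev n), s.indicator f' (φ x) = 0 := fun s => by
              by_cases hs : φ x ∈ s <;> simp [hs, hfx]
            simp [hz]
          · refine tendsto_const_nhds.congr' ?_
            have hev : ∀ᶠ k : ℕ in atTop, 1 / ((k : ℝ) + 1) < |f' (φ x)| :=
              (tendsto_order.1 (tendsto_one_div_add_atTop_nhds_zero_nat (𝕜 := ℝ))).2 _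
                (abs_pos.2 hfx)
            filter_upwards [hev] with k hk
            have hxK : φ x ∈ K k := ⟨hx, hk.le⟩
            simp [hx, hxK]
  have hi1 := integrableOn_comp_of_bounded hΩb hφ hf'.continuous.measurable (M := M) hM
  have hi2 := integrableOn_comp_of_bounded hΩb hφ
    (hf'.continuous.measurable.indicator hA.measurableSet.compl) (M := M)
    (fun x => (norm_indicator_le_norm_self f' x).trans (hM _))
  have := hw.add (hw0.const_smul (-1)) hi1 (hi2.const_mul (-1))
  simp only [smul_zero, add_zero] at this
  convert this using 1
  ext x
  by_cases hx : φ x ∈ A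
  · simp [hx, hff' hx]
  · simp [hx, h.2.1 _ hx]

/-- The standing assumptions on a mapping inducing a bounded composition operator. -/
structure IsCompSetting {n : ℕ} (Ω Ω' : Set (Ev n)) (φ : Ev n → Ev n) (p q C : ℝ≥0∞) : Prop where
  one_le_dim : 1 ≤ n
  isOpen : IsOpen Ω
  isBounded : Bornology.IsBounded Ω
  isOpen_target : IsOpen Ω'
  aemeasurable : AEMeasurable φ (volume.restrict Ω)
  one_le : 1 ≤ q
  lt : q < p
  const_lt_top : C < ⊤
  comp : CompOpBoundedLip Ω Ω' φ p q C

lemma IsCompSetting.one_le_left {n : ℕ} {Ω Ω' : Set (Ev n)} {φ : Ev n → Ev n} {p q C : ℝ≥0∞}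
    (H : IsCompSetting Ω Ω' φ p q C) : 1 ≤ p := H.one_le.trans H.lt.le

/-- Membership in the class of test functions of `PhiFun`. -/
def MemTest {n : ℕ} (p : ℝ≥0∞) (A : Set (Ev n)) (f : Ev n → ℝ) (Df : Ev n → Ev n) : Prop :=
  MemL1pZero p A f Df ∧ ∃ L : ℝ≥0, LipschitzOnWith L f A

lemma eLpNorm_restrict_inter_of_ae_eq_zero {n : ℕ} {p : ℝ≥0∞} {A B : Set (Ev n)} {D : Ev n → Ev n}
    (hA : MeasurableSet A) (hD : ∀ᵐ x, x ∉ A → D x = 0) (hAB : A ⊆ B) (S : Set (Ev n)) :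
    eLpNorm D p (volume.restrict (B ∩ S)) = eLpNorm D p (volume.restrict (A ∩ S)) := by
  have h1 : D =ᵐ[volume] A.indicator D := by
    filter_upwards [hD] with x hx
    by_cases hxA : x ∈ A
    · simp [hxA]
    · simp [hxA, hx]
  rw [eLpNorm_congr_ae (ae_restrict_of_ae h1), eLpNorm_indicator_eq_eLpNorm_restrict hA,
    Measure.restrict_restrict hA, ← inter_assoc, inter_eq_self_of_subset_left hAB]

/-- The Lipschitz representative of a test function, together with the weak gradient of the
composition. -/
lemma MemTest.exists_rep {n : ℕ} {Ω Ω' : Set (Ev n)} {φ : Ev n → Ev n} {p q C : ℝ≥0∞}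
    (H : IsCompSetting Ω Ω' φ p q C) {A : Set (Ev n)} (hA : IsOpen A)
    (hb : Bornology.IsBounded A) {f : Ev n → ℝ} {Df : Ev n → Ev n} (h : MemTest p A f Df) :
    ∃ (f' : Ev n → ℝ) (L : ℝ≥0) (D : Ev n → Ev n), LipschitzWith L f' ∧ f' =ᵐ[volume] f ∧
      EqOn f' f A ∧ (∀ x ∉ closure A, f' x = 0) ∧ Df =ᵐ[volume] gradient f' ∧
      IsWeakGrad Ω (f' ∘ φ) D ∧ IsWeakGrad Ω (f ∘ φ) D ∧
      eLpNorm D q (volume.restrict Ω) ≤ C * eLpNorm Df p (volume.restrict (A ∩ Ω')) := by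
  obtain ⟨h, L, hL⟩ := h
  obtain ⟨f', hf', hae, hon, h0, hD⟩ := h.exists_lipschitzWith H.one_le_left hA hb hL
  have hfin : eLpNorm (gradient f') p volume < ⊤ := by
    rw [← eLpNorm_congr_ae hD]
    exact h.2.2.1
  obtain ⟨D, hw, hle⟩ := H.comp.exists_isWeakGrad hf' hfin
  refine ⟨f', L, D, hf', hae, hon, h0, hD, hw, h.isWeakGrad_comp H.one_le_dim H.isBounded
    H.aemeasurable H.one_le_left H.one_le H.const_lt_top H.comp hA hb hf' hD hon h0 hw, ?_⟩
  have := eLpNorm_restrict_inter_of_ae_eq_zero (p := p) hA.measurableSet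
    (h.ae_eq_zero H.one_le_left hA.measurableSet) (subset_univ A) Ω'
  rwa [← this, univ_inter, eLpNorm_congr_ae (ae_restrict_of_ae hD)]

lemma MemTest.eLpNorm_lt_top {n : ℕ} {p : ℝ≥0∞} {A : Set (Ev n)} {f : Ev n → ℝ}
    {Df : Ev n → Ev n} (h : MemTest p A f Df) (S : Set (Ev n)) :
    eLpNorm Df p (volume.restrict S) < ⊤ :=
  (eLpNorm_restrict_le _ _ _ _).trans_lt h.1.2.2.1

lemma MemTest.eLpNorm_comp_le {n : ℕ} {Ω Ω' : Set (Ev n)} {φ : Ev n → Ev n} {p q C : ℝ≥0∞}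
    (H : IsCompSetting Ω Ω' φ p q C) {A : Set (Ev n)} (hA : IsOpen A)
    (hb : Bornology.IsBounded A) {f : Ev n → ℝ} {Df Dv : Ev n → Ev n} (h : MemTest p A f Df)
    (hv : IsWeakGrad Ω (f ∘ φ) Dv) :
    eLpNorm Dv q (volume.restrict Ω) ≤ C * eLpNorm Df p (volume.restrict (A ∩ Ω')) := by
  obtain ⟨f', L, D, -, -, -, -, -, -, hw, hle⟩ := h.exists_rep H hA hb
  rwa [eLpNorm_congr_ae (hv.ae_eq H.isOpen hw)]

lemma MemTest.eLpNorm_comp_lt_top {n : ℕ} {Ω Ω' : Set (Ev n)} {φ : Ev n → Ev n} {p q C : ℝ≥0∞}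
    (H : IsCompSetting Ω Ω' φ p q C) {A : Set (Ev n)} (hA : IsOpen A)
    (hb : Bornology.IsBounded A) {f : Ev n → ℝ} {Df Dv : Ev n → Ev n} (h : MemTest p A f Df)
    (hv : IsWeakGrad Ω (f ∘ φ) Dv) : eLpNorm Dv q (volume.restrict Ω) < ⊤ :=
  (h.eLpNorm_comp_le H hA hb hv).trans_lt
    (ENNReal.mul_lt_top H.const_lt_top (h.eLpNorm_lt_top _))

lemma MemTest.exists_bound {n : ℕ} {p : ℝ≥0∞} {A : Set (Ev n)} (hb : Bornology.IsBounded A)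
    {f : Ev n → ℝ} {Df : Ev n → Ev n} (h : MemTest p A f Df) : ∃ M : ℝ, ∀ x, |f x| ≤ M := by
  obtain ⟨h, L, hL⟩ := h
  obtain ⟨F, hF, hFf⟩ := hL.extend_real
  obtain ⟨M, hM⟩ := hb.isCompact_closure.exists_bound_of_continuousOn hF.continuous.continuousOn
  refine ⟨max M 0, fun x => ?_⟩
  by_cases hx : x ∈ A
  · rw [hFf hx]
    exact (hM x (subset_closure hx)).trans (le_max_left _ _)
  · simp [h.2.1 x hx]

lemma MemTest.measurable {n : ℕ} {p : ℝ≥0∞} {A : Set (Ev n)} (hA : IsOpen A)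
    {f : Ev n → ℝ} {Df : Ev n → Ev n} (h : MemTest p A f Df) : Measurable f := by
  obtain ⟨h, L, hL⟩ := h
  obtain ⟨F, hF, hFf⟩ := hL.extend_real
  have : f = A.indicator F := by
    ext x
    by_cases hx : x ∈ A
    · simp [hx, hFf hx]
    · simp [hx, h.2.1 x hx]
  rw [this]
  exact hF.continuous.measurable.indicator hA.measurableSet

lemma MemTest.integrableOn_comp {n : ℕ} {Ω Ω' : Set (Ev n)} {φ : Ev n → Ev n} {p q C : ℝ≥0∞}
    (H : IsCompSetting Ω Ω' φ p q C) {A : Set (Ev n)} (hA : IsOpen A)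
    (hb : Bornology.IsBounded A) {f : Ev n → ℝ} {Df : Ev n → Ev n} (h : MemTest p A f Df) :
    IntegrableOn (f ∘ φ) Ω := by
  obtain ⟨M, hM⟩ := h.exists_bound hb
  exact integrableOn_comp_of_bounded H.isBounded H.aemeasurable (h.measurable hA) hM

lemma IsWeakGrad.integrableOn_apply {n : ℕ} {Ω : Set (Ev n)} (hΩb : Bornology.IsBounded Ω)
    {q : ℝ≥0∞} (hq : 1 ≤ q) {u : Ev n → ℝ} {D : Ev n → Ev n} (h : IsWeakGrad Ω u D)
    (hfin : eLpNorm D q (volume.restrict Ω) < ⊤) (j : Fin n) : IntegrableOn (fun x => D x j) Ω := by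
  have : IsFiniteMeasure (volume.restrict Ω) := isFiniteMeasure_restrict.2 hΩb.measure_lt_top.ne
  have h1 : MemLp D q (volume.restrict Ω) := ⟨h.aestronglyMeasurable, hfin⟩
  exact (EuclideanSpace.proj j : Ev n →L[ℝ] ℝ).integrable_comp (h1.integrable hq)

/-- The weak gradient of the composition with a test function vanishes off the preimage. -/
lemma MemTest.comp_ae_eq_zero {n : ℕ} {Ω Ω' : Set (Ev n)} {φ : Ev n → Ev n} {p q C : ℝ≥0∞}
    (H : IsCompSetting Ω Ω' φ p q C) {A : Set (Ev n)} (hA : IsOpen A)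
    (hb : Bornology.IsBounded A) {f : Ev n → ℝ} {Df Dv : Ev n → Ev n} (h : MemTest p A f Df)
    (hv : IsWeakGrad Ω (f ∘ φ) Dv) : ∀ᵐ x ∂(volume.restrict Ω), φ x ∉ A → Dv x = 0 := by
  filter_upwards [hv.ae_eq_zero H.isOpen (h.integrableOn_comp H hA hb)
    (hv.integrableOn_apply H.isBounded H.one_le (h.eLpNorm_comp_lt_top H hA hb hv))] with x hx hxA
  exact hx (h.1.2.1 _ hxA)

lemma memTest_zero {n : ℕ} (p : ℝ≥0∞) (A : Set (Ev n)) :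
    MemTest p A (fun _ => 0) (fun _ => 0) := by
  refine ⟨⟨isWeakGrad_zero _, fun _ _ => rfl, by simp, fun ε hε => ⟨fun _ => 0, contDiff_const,
    HasCompactSupport.zero, by simp [tsupport], ?_⟩⟩, 0, LipschitzWith.const _ |>.lipschitzOnWith⟩
  have : gradient (fun _ : Ev n => (0 : ℝ)) = fun _ => 0 := by
    ext1 x; simp [gradient]
  simp [this, hε]

/-- The ratios whose supremum is `PhiFun`. -/
def ratioSet {n : ℕ} (Ω Ω' : Set (Ev n)) (φ : Ev n → Ev n) (p q : ℝ≥0∞) (σ : ℝ)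
    (A : Set (Ev n)) : Set ℝ :=
  {t : ℝ | ∃ (f : Ev n → ℝ) (Df Dv : Ev n → Ev n), MemTest p A f Df ∧ IsWeakGrad Ω (f ∘ φ) Dv ∧
    t = ((eLpNorm Dv q (volume.restrict Ω)).toReal /
         (eLpNorm Df p (volume.restrict (A ∩ Ω'))).toReal) ^ σ}

lemma phiFun_eq_sSup_ratioSet {n : ℕ} (Ω Ω' : Set (Ev n)) (φ : Ev n → Ev n) (p q : ℝ≥0∞) (σ : ℝ)
    (A : Set (Ev n)) : PhiFun Ω Ω' φ p q σ A = sSup (ratioSet Ω Ω' φ p q σ A) := by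
  rw [PhiFun, ratioSet]
  congr 1
  ext t
  constructor
  · rintro ⟨f, Df, L, Dv, h, hL, hv, rfl⟩
    exact ⟨f, Df, Dv, ⟨h, L, hL⟩, hv, rfl⟩
  · rintro ⟨f, Df, Dv, ⟨h, L, hL⟩, hv, rfl⟩
    exact ⟨f, Df, L, Dv, h, hL, hv, rfl⟩

lemma ratioSet_nonempty {n : ℕ} (Ω Ω' : Set (Ev n)) (φ : Ev n → Ev n) (p q : ℝ≥0∞) (σ : ℝ)
    (A : Set (Ev n)) : (ratioSet Ω Ω' φ p q σ A).Nonempty :=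
  ⟨_, fun _ => 0, fun _ => 0, fun _ => 0, memTest_zero p A, isWeakGrad_zero Ω, rfl⟩

lemma MemTest.toReal_comp_le {n : ℕ} {Ω Ω' : Set (Ev n)} {φ : Ev n → Ev n} {p q C : ℝ≥0∞}
    (H : IsCompSetting Ω Ω' φ p q C) {A : Set (Ev n)} (hA : IsOpen A)
    (hb : Bornology.IsBounded A) {f : Ev n → ℝ} {Df Dv : Ev n → Ev n} (h : MemTest p A f Df)
    (hv : IsWeakGrad Ω (f ∘ φ) Dv) :
    (eLpNorm Dv q (volume.restrict Ω)).toReal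
      ≤ C.toReal * (eLpNorm Df p (volume.restrict (A ∩ Ω'))).toReal := by
  rw [← ENNReal.toReal_mul]
  exact ENNReal.toReal_mono
    (ENNReal.mul_lt_top H.const_lt_top (h.eLpNorm_lt_top _)).ne (h.eLpNorm_comp_le H hA hb hv)

lemma IsCompSetting.ratio_le {n : ℕ} {Ω Ω' : Set (Ev n)} {φ : Ev n → Ev n} {p q C : ℝ≥0∞}
    (H : IsCompSetting Ω Ω' φ p q C) {σ : ℝ} (hσ : 0 ≤ σ) {A : Set (Ev n)} (hA : IsOpen A)
    (hb : Bornology.IsBounded A) {t : ℝ} (ht : t ∈ ratioSet Ω Ω' φ p q σ A) :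
    t ≤ C.toReal ^ σ := by
  obtain ⟨f, Df, Dv, h, hv, rfl⟩ := ht
  exact Real.rpow_le_rpow (by positivity)
    (div_le_of_le_mul₀ (by positivity) (by positivity) (h.toReal_comp_le H hA hb hv)) hσ

lemma IsCompSetting.bddAbove_ratioSet {n : ℕ} {Ω Ω' : Set (Ev n)} {φ : Ev n → Ev n}
    {p q C : ℝ≥0∞} (H : IsCompSetting Ω Ω' φ p q C) {σ : ℝ} (hσ : 0 ≤ σ) {A : Set (Ev n)}
    (hA : IsOpen A) (hb : Bornology.IsBounded A) : BddAbove (ratioSet Ω Ω' φ p q σ A) :=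
  ⟨_, fun _ ht => H.ratio_le hσ hA hb ht⟩

lemma phiFun_nonneg {n : ℕ} (Ω Ω' : Set (Ev n)) (φ : Ev n → Ev n) (p q : ℝ≥0∞) (σ : ℝ)
    (A : Set (Ev n)) : 0 ≤ PhiFun Ω Ω' φ p q σ A := by
  rw [phiFun_eq_sSup_ratioSet]
  refine Real.sSup_nonneg ?_
  rintro t ⟨f, Df, Dv, -, -, rfl⟩
  positivity

lemma IsCompSetting.phiFun_mono {n : ℕ} {Ω Ω' : Set (Ev n)} {φ : Ev n → Ev n} {p q C : ℝ≥0∞}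
    (H : IsCompSetting Ω Ω' φ p q C) {σ : ℝ} (hσ : 0 ≤ σ) {A B : Set (Ev n)} (hA : IsOpen A)
    (hAb : Bornology.IsBounded A) (hB : IsOpen B) (hBb : Bornology.IsBounded B) (hAB : A ⊆ B) :
    PhiFun Ω Ω' φ p q σ A ≤ PhiFun Ω Ω' φ p q σ B := by
  rw [phiFun_eq_sSup_ratioSet, phiFun_eq_sSup_ratioSet]
  refine csSup_le_csSup (H.bddAbove_ratioSet hσ hB hBb) (ratioSet_nonempty _ _ _ _ _ _ _) ?_
  rintro t ⟨f, Df, Dv, h, hv, rfl⟩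
  obtain ⟨f', L, D, hf', hae, hon, h0, hD, hw', hw, -⟩ := h.exists_rep H hA hAb
  have hg : B.indicator f' =ᵐ[volume] f := by
    filter_upwards [hae] with x hx
    by_cases hxB : x ∈ B
    · simp [hxB, hx]
    · simp [hxB, h.1.2.1 x (fun hxA => hxB (hAB hxA))]
  have hBf : EqOn f' (B.indicator f') B := fun x hx => by simp [hx]
  have hB' : MemL1pZero p B (B.indicator f') Df := by
    refine ⟨h.1.1.congr (ae_restrict_of_ae hg.symm), fun x hx => by simp [hx], h.1.2.2.1,
      fun ε hε => ?_⟩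
    obtain ⟨g, h1, h2, h3, h4⟩ := h.1.2.2.2 ε hε
    exact ⟨g, h1, h2, h3.trans hAB, h4⟩
  have hT : MemTest p B (B.indicator f') Df :=
    ⟨hB', L, fun x hx y hy => by simpa [hx, hy] using hf' x y⟩
  refine ⟨B.indicator f', Df, D, hT, hB'.isWeakGrad_comp H.one_le_dim H.isBounded
    H.aemeasurable H.one_le_left H.one_le H.const_lt_top H.comp hB hBb hf' hD hBf
    (fun x hx => h0 x (fun hxA => hx (closure_mono hAB hxA))) hw', ?_⟩
  rw [eLpNorm_congr_ae (hv.ae_eq H.isOpen hw), eLpNorm_restrict_inter_of_ae_eq_zero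
    hA.measurableSet (h.1.ae_eq_zero H.one_le_left hA.measurableSet) hAB]

lemma eLpNorm_rpow_toReal {n : ℕ} {μ : Measure (Ev n)} {p : ℝ≥0∞} (h0 : p ≠ 0) (ht : p ≠ ⊤)
    (f : Ev n → Ev n) : eLpNorm f p μ ^ p.toReal = ∫⁻ x, ‖f x‖ₑ ^ p.toReal ∂μ := by
  have hp : 0 < p.toReal := ENNReal.toReal_pos h0 ht
  rw [eLpNorm_eq_lintegral_rpow_enorm_toReal h0 ht, ← ENNReal.rpow_mul, one_div_mul_cancel hp.ne',
    ENNReal.rpow_one]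

/-- Additivity of the `p`-th power of the `L_p`-norm over fields with disjoint supports. -/
lemma eLpNorm_sum_rpow_of_disjoint {n : ℕ} {μ : Measure (Ev n)} {p : ℝ≥0∞} (h0 : p ≠ 0)
    (ht : p ≠ ⊤) (F : Finset ℕ) {E : ℕ → Ev n → Ev n}
    (hE : ∀ i ∈ F, AEStronglyMeasurable (E i) μ)
    (hd : ∀ᵐ x ∂μ, ∀ i j, i ≠ j → E i x = 0 ∨ E j x = 0) :
    eLpNorm (fun x => ∑ i ∈ F, E i x) p μ ^ p.toReal = ∑ i ∈ F, eLpNorm (E i) p μ ^ p.toReal := by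
  have hp : 0 < p.toReal := ENNReal.toReal_pos h0 ht
  simp only [eLpNorm_rpow_toReal h0 ht]
  rw [← lintegral_finsetSum' F (fun i hi => ((hE i hi).enorm.pow_const _))]
  refine lintegral_congr_ae ?_
  filter_upwards [hd] with x hx
  by_cases hex : ∃ i ∈ F, E i x ≠ 0
  · obtain ⟨i, hi, hix⟩ := hex
    have hj : ∀ j ∈ F, j ≠ i → E j x = 0 := fun j _ hji => (hx j i hji).resolve_right hix
    rw [Finset.sum_eq_single_of_mem i hi hj, Finset.sum_eq_single_of_mem i hi]
    intro j hjF hji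
    simp [hj j hjF hji, hp]
  · push Not at hex
    rw [Finset.sum_eq_zero hex, Finset.sum_eq_zero]
    · simp [hp]
    · intro j hj
      simp [hex j hj, hp]

lemma eLpNorm_top_sum_le_of_disjoint {n : ℕ} {μ : Measure (Ev n)} (F : Finset ℕ)
    {E : ℕ → Ev n → Ev n} {M : ℝ≥0∞} (hM : ∀ i, eLpNorm (E i) ⊤ μ ≤ M)
    (hd : ∀ᵐ x ∂μ, ∀ i j, i ≠ j → E i x = 0 ∨ E j x = 0) :
    eLpNorm (fun x => ∑ i ∈ F, E i x) ⊤ μ ≤ M := by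
  simp only [eLpNorm_exponent_top] at hM ⊢
  refine essSup_le_of_ae_le _ ?_
  have hM' : ∀ᵐ x ∂μ, ∀ i, ‖E i x‖ₑ ≤ M := ae_all_iff.2 fun i => by
    filter_upwards [ae_le_eLpNormEssSup (f := E i) (μ := μ)] with x hx using hx.trans (hM i)
  filter_upwards [hd, hM'] with x hx hxM
  by_cases hex : ∃ i ∈ F, E i x ≠ 0
  · obtain ⟨i, hi, hix⟩ := hex
    rw [Finset.sum_eq_single_of_mem i hi fun j _ hji => (hx j i hji).resolve_right hix]
    exact hxM i
  · push Not at hex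
    rw [Finset.sum_eq_zero hex]
    simp

lemma MemTest.integrable {n : ℕ} {p : ℝ≥0∞} {A : Set (Ev n)} (hA : IsOpen A)
    (hb : Bornology.IsBounded A) {f : Ev n → ℝ} {Df : Ev n → Ev n} (h : MemTest p A f Df) :
    Integrable f := by
  obtain ⟨M, hM⟩ := h.exists_bound hb
  have : IsFiniteMeasure (volume.restrict A) := isFiniteMeasure_restrict.2 hb.measure_lt_top.ne
  have h1 : IntegrableOn f A := Integrable.of_bound (h.measurable hA).aestronglyMeasurable M
    (Eventually.of_forall hM)
  refine (h1.integrable_indicator hA.measurableSet).congr (Eventually.of_forall fun x => ?_)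
  by_cases hx : x ∈ A
  · simp [hx]
  · simp [hx, h.1.2.1 x hx]

lemma gradient_add_of_contDiff {n : ℕ} {g h : Ev n → ℝ} (hg : ContDiff ℝ (⊤ : ℕ∞) g)
    (hh : ContDiff ℝ (⊤ : ℕ∞) h) (x : Ev n) :
    gradient (fun y => g y + h y) x = gradient g x + gradient h x := by
  simp only [gradient]
  rw [fderiv_fun_add (hg.differentiable (by simp) x) (hh.differentiable (by simp) x), map_add]

lemma gradient_const_mul_of_contDiff {n : ℕ} {g : Ev n → ℝ} (hg : ContDiff ℝ (⊤ : ℕ∞) g) (c : ℝ)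
    (x : Ev n) : gradient (fun y => c * g y) x = c • gradient g x := by
  simp only [gradient]
  rw [fderiv_const_mul (hg.differentiable (by simp) x)]
  simp

lemma MemL1pZero.aestronglyMeasurable_sub_gradient {n : ℕ} {p : ℝ≥0∞} {A : Set (Ev n)}
    {f g : Ev n → ℝ} {Df : Ev n → Ev n} (h : MemL1pZero p A f Df) :
    AEStronglyMeasurable (fun x => Df x - gradient g x) volume :=
  (by simpa using h.1.aestronglyMeasurable : AEStronglyMeasurable Df volume).sub
    (measurable_gradient g).aestronglyMeasurable

lemma MemTest.add {n : ℕ} {p : ℝ≥0∞} (hp : 1 ≤ p) {A : Set (Ev n)} (hA : IsOpen A)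
    (hb : Bornology.IsBounded A) {f g : Ev n → ℝ} {Df Dg : Ev n → Ev n} (h : MemTest p A f Df)
    (h' : MemTest p A g Dg) : MemTest p A (fun x => f x + g x) (fun x => Df x + Dg x) := by
  have hf := h.integrable hA hb
  have hg := h'.integrable hA hb
  obtain ⟨h, L, hL⟩ := h
  obtain ⟨h', L', hL'⟩ := h'
  refine ⟨⟨h.1.add h'.1 hf.integrableOn hg.integrableOn,
    fun x hx => by simp [h.2.1 x hx, h'.2.1 x hx], ?_, fun ε hε => ?_⟩, L + L', hL.add hL'⟩
  · refine (eLpNorm_add_le ?_ ?_ hp).trans_lt (ENNReal.add_lt_top.2 ⟨h.2.2.1, h'.2.2.1⟩)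
    · simpa using h.1.aestronglyMeasurable
    · simpa using h'.1.aestronglyMeasurable
  · obtain ⟨u, hu, huc, hus, hue⟩ := h.2.2.2 (ε / 2) (half_pos hε)
    obtain ⟨v, hv, hvc, hvs, hve⟩ := h'.2.2.2 (ε / 2) (half_pos hε)
    refine ⟨fun x => u x + v x, hu.add hv, huc.add hvc,
      (tsupport_add u v).trans (union_subset hus hvs), ?_⟩
    have e : (fun x => Df x + Dg x - gradient (fun y => u y + v y) x)
        = (fun x => Df x - gradient u x) + fun x => Dg x - gradient v x := by
      ext1 x
      simp only [Pi.add_apply, gradient_add_of_contDiff hu hv]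
      abel
    rw [e]
    refine (eLpNorm_add_le h.aestronglyMeasurable_sub_gradient
      h'.aestronglyMeasurable_sub_gradient hp).trans_lt ((ENNReal.add_lt_add hue hve).trans_eq ?_)
    rw [← ENNReal.ofReal_add (by positivity) (by positivity), add_halves]

lemma MemTest.const_mul {n : ℕ} {p : ℝ≥0∞} {A : Set (Ev n)}
    {f : Ev n → ℝ} {Df : Ev n → Ev n} (h : MemTest p A f Df) (c : ℝ) :
    MemTest p A (fun x => c * f x) (fun x => c • Df x) := by
  obtain ⟨h, L, hL⟩ := h
  have hsm : ∀ E : Ev n → Ev n,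
      eLpNorm (fun x => c • E x) p volume = ‖c‖ₑ * eLpNorm E p volume := fun E =>
    eLpNorm_const_smul c E p volume
  refine ⟨⟨h.1.const_smul c, fun x hx => by simp [h.2.1 x hx], ?_, fun ε hε => ?_⟩, ‖c‖₊ * L,
    fun x hx y hy => ?_⟩
  · rw [hsm]
    exact ENNReal.mul_lt_top enorm_lt_top h.2.2.1
  · obtain ⟨u, hu, huc, hus, hue⟩ := h.2.2.2 (ε / (|c| + 1)) (by positivity)
    refine ⟨fun x => c * u x, contDiff_const.mul hu, huc.mul_left, ?_, ?_⟩
    · exact (closure_mono (Function.support_mul_subset_right _ _)).trans hus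
    · have e : (fun x => c • Df x - gradient (fun y => c * u y) x)
          = fun x => c • (Df x - gradient u x) := by
        ext1 x
        rw [gradient_const_mul_of_contDiff hu, smul_sub]
      rw [e, hsm]
      refine (mul_le_mul_right hue.le _).trans_lt ?_
      rw [← ofReal_norm, Real.norm_eq_abs, ← ENNReal.ofReal_mul (abs_nonneg _)]
      refine (ENNReal.ofReal_lt_ofReal_iff hε).2 ?_
      rw [mul_div_assoc', div_lt_iff₀ (by positivity)]
      nlinarith [abs_nonneg c]
  · rw [edist_eq_enorm_sub, ← mul_sub, enorm_mul, ← edist_eq_enorm_sub, ENNReal.coe_mul, mul_assoc]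
    exact mul_le_mul_right (hL hx hy) _

lemma MemTest.sum {n : ℕ} {p : ℝ≥0∞} (hp : 1 ≤ p) {A : Set (Ev n)} (hA : IsOpen A)
    (hb : Bornology.IsBounded A) (F : Finset ℕ) {f : ℕ → Ev n → ℝ} {Df : ℕ → Ev n → Ev n}
    (h : ∀ i, MemTest p A (f i) (Df i)) :
    MemTest p A (fun x => ∑ i ∈ F, f i x) (fun x => ∑ i ∈ F, Df i x) := by
  induction F using Finset.induction_on with
  | empty => simpa using memTest_zero p A
  | insert i F hi ih => simpa only [Finset.sum_insert hi] using (h i).add hp hA hb ih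

/-- A test function for a member of a disjoint family is a test function for the union. -/
lemma MemTest.iUnion {n : ℕ} {p : ℝ≥0∞} (hp : 1 ≤ p) {U : ℕ → Set (Ev n)}
    (hU : ∀ i, IsOpen (U i)) (hd : Pairwise (Function.onFun Disjoint U)) {i : ℕ}
    (hb : Bornology.IsBounded (U i)) {f : Ev n → ℝ} {Df : Ev n → Ev n}
    (h : MemTest p (U i) f Df) : MemTest p (⋃ j, U j) f Df := by
  obtain ⟨h, L, hL⟩ := h
  obtain ⟨f', hf', -, hon, h0, -⟩ := h.exists_lipschitzWith hp (hU i) hb hL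
  have hon' : EqOn f' f (⋃ j, U j) := by
    intro x hx
    obtain ⟨j, hj⟩ := mem_iUnion.1 hx
    rcases eq_or_ne j i with rfl | hji
    · exact hon hj
    · have hcl := (hd hji).closure_right (hU j)
      have hx' : x ∉ closure (U i) := Set.disjoint_left.1 hcl hj
      rw [h0 x hx', h.2.1 x (fun hx'' => hx' (subset_closure hx''))]
  refine ⟨⟨h.1, fun x hx => h.2.1 x (fun hx' => hx (mem_iUnion_of_mem i hx')), h.2.2.1,
    fun ε hε => ?_⟩, L, fun x hx y hy => ?_⟩
  · obtain ⟨g, h1, h2, h3, h4⟩ := h.2.2.2 ε hε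
    exact ⟨g, h1, h2, h3.trans (subset_iUnion U i), h4⟩
  · rw [← hon' hx, ← hon' hy]
    exact hf' x y

/-- Choice of the coefficient with which a test function of ratio `t` enters a sum. -/
lemma exists_coeff_of_ratio {P Q σ a b t : ℝ} (hP : 0 ≤ P) (hQ : 0 < Q) (hσ : 0 < σ)
    (hexp : 1 / Q = 1 / P + 1 / σ) (ha : 0 ≤ a) (hb : 0 ≤ b) (hab : b = 0 → a = 0)
    (ht : t = (a / b) ^ σ) :
    ∃ c : ℝ, 0 ≤ c ∧ c * a = t ^ (1 / Q) ∧ c * b ≤ t ^ (1 / P) := by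
  have ht0 : 0 ≤ t := by rw [ht]; positivity
  rcases hb.eq_or_lt with hb0 | hb0
  · refine ⟨0, le_rfl, ?_, ?_⟩
    · rw [ht, ← hb0, hab hb0.symm, div_zero, Real.zero_rpow hσ.ne',
        Real.zero_rpow (by positivity), mul_zero]
    · rw [zero_mul]; positivity
  · refine ⟨t ^ (1 / P) / b, by positivity, ?_, (div_mul_cancel₀ _ hb0.ne').le⟩
    have h1 : a / b = t ^ (1 / σ) := by
      rw [ht, ← Real.rpow_mul (by positivity), mul_one_div_cancel hσ.ne', Real.rpow_one]
    rw [div_mul_eq_mul_div, mul_div_assoc, h1, hexp]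
    rcases ht0.eq_or_lt with h0 | h0
    · rw [← h0, Real.zero_rpow (by positivity : 1 / σ ≠ 0), mul_zero, Real.zero_rpow]
      have : 0 < 1 / σ := by positivity
      positivity
    · rw [Real.rpow_add h0]

lemma le_rpow_div_of_le {P Q σ a b S : ℝ} (hσ : 0 < σ)
    (hexp : 1 / Q = 1 / P + 1 / σ) (hb : 0 ≤ b) (hS : 0 ≤ S) (hab : b = 0 → a = 0)
    (haS : a = S ^ (1 / Q)) (hbS : b ≤ S ^ (1 / P)) : S ≤ (a / b) ^ σ := by
  rcases hS.eq_or_lt with rfl | hS0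
  · have : 0 ≤ a := by rw [haS]; positivity
    positivity
  have ha : 0 < a := by rw [haS]; positivity
  have hb0 : 0 < b := hb.lt_of_ne fun h => ha.ne' (hab h.symm)
  have h1 : S ^ (1 / σ) ≤ a / b := by
    rw [le_div_iff₀ hb0]
    calc S ^ (1 / σ) * b ≤ S ^ (1 / σ) * S ^ (1 / P) := by gcongr
      _ = a := by rw [haS, hexp, add_comm, Real.rpow_add hS0]
  calc S = (S ^ (1 / σ)) ^ σ := by
        rw [← Real.rpow_mul hS, one_div_mul_cancel hσ.ne', Real.rpow_one]
    _ ≤ (a / b) ^ σ := by gcongr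

lemma toReal_eLpNorm_const_smul {n : ℕ} {μ : Measure (Ev n)} {p : ℝ≥0∞} {c : ℝ} (hc : 0 ≤ c)
    (E : Ev n → Ev n) :
    (eLpNorm (fun x => c • E x) p μ).toReal = c * (eLpNorm E p μ).toReal := by
  have h := eLpNorm_const_smul c E p μ
  have h' : eLpNorm (fun x => c • E x) p μ = ‖c‖ₑ * eLpNorm E p μ := h
  rw [h', ENNReal.toReal_mul, toReal_enorm, Real.norm_of_nonneg hc]

lemma toReal_eLpNorm_sum_rpow_of_disjoint {n : ℕ} {μ : Measure (Ev n)} {p : ℝ≥0∞} (h0 : p ≠ 0)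
    (ht : p ≠ ⊤) (F : Finset ℕ) {E : ℕ → Ev n → Ev n}
    (hE : ∀ i ∈ F, AEStronglyMeasurable (E i) μ) (hfin : ∀ i, eLpNorm (E i) p μ < ⊤)
    (hd : ∀ᵐ x ∂μ, ∀ i j, i ≠ j → E i x = 0 ∨ E j x = 0) :
    (eLpNorm (fun x => ∑ i ∈ F, E i x) p μ).toReal
      = (∑ i ∈ F, (eLpNorm (E i) p μ).toReal ^ p.toReal) ^ (1 / p.toReal) := by
  have hp : 0 < p.toReal := ENNReal.toReal_pos h0 ht
  have h := congrArg ENNReal.toReal (eLpNorm_sum_rpow_of_disjoint h0 ht F hE hd)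
  rw [ENNReal.toReal_sum fun i _ => ENNReal.rpow_ne_top_of_nonneg hp.le (hfin i).ne] at h
  simp only [← ENNReal.toReal_rpow] at h
  rw [← h, ← Real.rpow_mul ENNReal.toReal_nonneg, mul_one_div_cancel hp.ne', Real.rpow_one]

lemma IsCompSetting.sum_le_phiFun {n : ℕ} {Ω Ω' : Set (Ev n)} {φ : Ev n → Ev n} {p q C : ℝ≥0∞}
    (H : IsCompSetting Ω Ω' φ p q C) {σ : ℝ} (hσ : 0 < σ)
    (hexp : 1 / q.toReal = 1 / p.toReal + 1 / σ) {U : ℕ → Set (Ev n)} (hU : ∀ i, IsOpen (U i))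
    (hd : Pairwise (Function.onFun Disjoint U)) (hb : Bornology.IsBounded (⋃ i, U i)) {t : ℕ → ℝ}
    (ht : ∀ i, t i ∈ ratioSet Ω Ω' φ p q σ (U i)) (F : Finset ℕ) :
    ∑ i ∈ F, t i ≤ PhiFun Ω Ω' φ p q σ (⋃ i, U i) := by
  have hqt : q ≠ ⊤ := H.lt.ne_top
  have hq0 : q ≠ 0 := (zero_lt_one.trans_le H.one_le).ne'
  have hQ : 0 < q.toReal := ENNReal.toReal_pos hq0 hqt
  have hUo : IsOpen (⋃ i, U i) := isOpen_iUnion hU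
  have hUb : ∀ i, Bornology.IsBounded (U i) := fun i => hb.subset (subset_iUnion U i)
  choose f Df Dv h hv htr using ht
  have ht0 : ∀ i, 0 ≤ t i := fun i => by rw [htr]; positivity
  choose c hc hca hcb using fun i => exists_coeff_of_ratio (P := p.toReal) ENNReal.toReal_nonneg hQ
    hσ hexp ENNReal.toReal_nonneg ENNReal.toReal_nonneg
    (fun hz => le_antisymm (((h i).toReal_comp_le H (hU i) (hUb i) (hv i)).trans (by rw [hz, mul_zero]))
      ENNReal.toReal_nonneg) (htr i)
  have hT : ∀ i, MemTest p (⋃ j, U j) (fun x => c i * f i x) (fun x => c i • Df i x) := fun i =>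
    ((h i).iUnion H.one_le_left hU hd (hUb i)).const_mul (c i)
  have hTs := MemTest.sum H.one_le_left hUo hb F hT
  have hvs : IsWeakGrad Ω (fun x => ∑ i ∈ F, c i * (f i ∘ φ) x) (fun x => ∑ i ∈ F, c i • Dv i x) :=
    IsWeakGrad.sum F (fun i _ => (hv i).const_smul (c i))
      (fun i _ => ((h i).integrableOn_comp H (hU i) (hUb i)).const_mul (c i))
  have hnum : (eLpNorm (fun x => ∑ i ∈ F, c i • Dv i x) q (volume.restrict Ω)).toReal
      = (∑ i ∈ F, t i) ^ (1 / q.toReal) := by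
    rw [toReal_eLpNorm_sum_rpow_of_disjoint hq0 hqt F (E := fun i x => c i • Dv i x)
      (fun i _ => (hv i).aestronglyMeasurable.const_smul (c i))]
    · congr 1
      refine Finset.sum_congr rfl fun i _ => ?_
      rw [toReal_eLpNorm_const_smul (hc i), hca, ← Real.rpow_mul (ht0 i), one_div_mul_cancel hQ.ne',
        Real.rpow_one]
    · intro i
      have e : eLpNorm (fun x => c i • Dv i x) q (volume.restrict Ω)
          = ‖c i‖ₑ * eLpNorm (Dv i) q (volume.restrict Ω) := eLpNorm_const_smul (c i) (Dv i) _ _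
      rw [e]
      exact ENNReal.mul_lt_top enorm_lt_top ((h i).eLpNorm_comp_lt_top H (hU i) (hUb i) (hv i))
    · filter_upwards [ae_all_iff.2 fun i => (h i).comp_ae_eq_zero H (hU i) (hUb i) (hv i)]
        with x hx i j hij
      by_cases hxi : φ x ∈ U i
      · right
        rw [hx j (Set.disjoint_left.1 (hd hij) hxi), smul_zero]
      · left
        rw [hx i hxi, smul_zero]
  set μ := volume.restrict ((⋃ i, U i) ∩ Ω') with hμ
  have hDf0 : ∀ i, ∀ᵐ x, x ∉ U i → Df i x = 0 := fun i =>
    (h i).1.ae_eq_zero H.one_le_left (hU i).measurableSet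
  have hbi : ∀ i, (eLpNorm (fun x => c i • Df i x) p μ).toReal ≤ t i ^ (1 / p.toReal) := fun i => by
    rw [toReal_eLpNorm_const_smul (hc i), hμ, eLpNorm_restrict_inter_of_ae_eq_zero
      (hU i).measurableSet (hDf0 i) (subset_iUnion U i)]
    exact hcb i
  have hbf : ∀ i, eLpNorm (fun x => c i • Df i x) p μ < ⊤ := fun i => (hT i).eLpNorm_lt_top _
  have hdis : ∀ᵐ x ∂μ, ∀ i j, i ≠ j → c i • Df i x = 0 ∨ c j • Df j x = 0 := by
    filter_upwards [ae_restrict_of_ae (ae_all_iff.2 hDf0)] with x hx i j hij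
    by_cases hxi : x ∈ U i
    · right
      rw [hx j (Set.disjoint_left.1 (hd hij) hxi), smul_zero]
    · left
      rw [hx i hxi, smul_zero]
  have hden : (eLpNorm (fun x => ∑ i ∈ F, c i • Df i x) p μ).toReal
      ≤ (∑ i ∈ F, t i) ^ (1 / p.toReal) := by
    rcases eq_or_ne p ⊤ with rfl | hpt
    · simp only [ENNReal.toReal_top, div_zero, Real.rpow_zero] at hbi ⊢
      refine ENNReal.toReal_le_of_le_ofReal zero_le_one
        (eLpNorm_top_sum_le_of_disjoint F (E := fun i x => c i • Df i x)
          (fun i => ?_) hdis)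
      rw [← ENNReal.ofReal_toReal (hbf i).ne]
      exact ENNReal.ofReal_le_ofReal (hbi i)
    · have hp0 : p ≠ 0 := (zero_lt_one.trans_le H.one_le_left).ne'
      have hP : 0 < p.toReal := ENNReal.toReal_pos hp0 hpt
      rw [toReal_eLpNorm_sum_rpow_of_disjoint hp0 hpt F (E := fun i x => c i • Df i x)
        (fun i _ => ?_) hbf hdis]
      · refine Real.rpow_le_rpow (by positivity) (Finset.sum_le_sum fun i _ => ?_) (by positivity)
        calc _ ≤ (t i ^ (1 / p.toReal)) ^ p.toReal := by gcongr; exact hbi i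
          _ = t i := by rw [← Real.rpow_mul (ht0 i), one_div_mul_cancel hP.ne', Real.rpow_one]
      · exact ((hT i).1.1.mono (subset_univ _)).aestronglyMeasurable
  have hle := le_rpow_div_of_le hσ hexp ENNReal.toReal_nonneg (Finset.sum_nonneg fun i _ => ht0 i)
    (fun hz => le_antisymm ((hTs.toReal_comp_le H hUo hb hvs).trans (by rw [hz, mul_zero]))
      ENNReal.toReal_nonneg) hnum hden
  rw [phiFun_eq_sSup_ratioSet]
  exact hle.trans (le_csSup (H.bddAbove_ratioSet hσ.le hUo hb) ⟨_, _, _, hTs, hvs, rfl⟩)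

lemma tsupport_indicator_subset_of_disjoint {n : ℕ} {U : ℕ → Set (Ev n)} (hU : ∀ i, IsOpen (U i))
    (hd : Pairwise (Function.onFun Disjoint U)) {g : Ev n → ℝ} (hg : tsupport g ⊆ ⋃ i, U i)
    (i : ℕ) : tsupport ((U i).indicator g) ⊆ tsupport g ∩ U i := by
  have hK : tsupport g ∩ U i = tsupport g \ ⋃ j, ⋃ _ : j ≠ i, U j := by
    ext x
    simp only [mem_inter_iff, Set.mem_sdiff, mem_iUnion, not_exists]
    refine and_congr_right fun hx => ⟨fun hxi j hji hxj =>
      Set.disjoint_left.1 (hd hji) hxj hxi, fun hall => ?_⟩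
    obtain ⟨j, hj⟩ := mem_iUnion.1 (hg hx)
    by_cases hji : j = i
    · exact hji ▸ hj
    · exact absurd hj (hall j hji)
  have hcl : IsClosed (tsupport g ∩ U i) := by
    rw [hK]
    exact (isClosed_tsupport g).sdiff (isOpen_iUnion fun j => isOpen_iUnion fun _ => hU j)
  refine closure_minimal (fun x hx => ?_) hcl
  rw [Set.support_indicator] at hx
  exact ⟨subset_tsupport g hx.2, hx.1⟩

lemma contDiff_indicator_of_disjoint {n : ℕ} {U : ℕ → Set (Ev n)} (hU : ∀ i, IsOpen (U i))
    (hd : Pairwise (Function.onFun Disjoint U)) {g : Ev n → ℝ} (hgd : ContDiff ℝ (⊤ : ℕ∞) g)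
    (hg : tsupport g ⊆ ⋃ i, U i) (i : ℕ) : ContDiff ℝ (⊤ : ℕ∞) ((U i).indicator g) := by
  refine contDiff_iff_contDiffAt.2 fun x => ?_
  by_cases hx : x ∈ U i
  · refine hgd.contDiffAt.congr_of_eventuallyEq ?_
    filter_upwards [(hU i).mem_nhds hx] with y hy
    simp [hy]
  · have hx' : x ∉ tsupport ((U i).indicator g) := fun h =>
      hx (tsupport_indicator_subset_of_disjoint hU hd hg i h).2
    refine contDiffAt_const (c := (0 : ℝ)) |>.congr_of_eventuallyEq ?_
    exact notMem_tsupport_iff_eventuallyEq.1 hx'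

lemma gradient_indicator_of_disjoint {n : ℕ} {U : ℕ → Set (Ev n)} (hU : ∀ i, IsOpen (U i))
    (hd : Pairwise (Function.onFun Disjoint U)) {g : Ev n → ℝ} (hg : tsupport g ⊆ ⋃ i, U i)
    (i : ℕ) : gradient ((U i).indicator g) = (U i).indicator (gradient g) := by
  ext1 x
  by_cases hx : x ∈ U i
  · rw [indicator_of_mem hx]
    refine Filter.EventuallyEq.gradient_eq ?_
    filter_upwards [(hU i).mem_nhds hx] with y hy
    simp [hy]
  · have hx' : x ∉ tsupport ((U i).indicator g) := fun h =>
      hx (tsupport_indicator_subset_of_disjoint hU hd hg i h).2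
    rw [indicator_of_notMem hx, (notMem_tsupport_iff_eventuallyEq.1 hx').gradient_eq]
    exact gradient_fun_const x 0

lemma isWeakGrad_univ_of_tendsto {n : ℕ} {p : ℝ≥0∞} (hp : 1 ≤ p)
    {u : ℕ → Ev n → ℝ} {D : ℕ → Ev n → Ev n} {v : Ev n → ℝ} {E : Ev n → Ev n}
    (hE : ∀ j, LocallyIntegrableOn (fun x => E x j) univ) (h : ∀ k, IsWeakGrad univ (u k) (D k))
    (hui : ∀ k, Integrable (u k)) (hvi : Integrable v)
    (hu : Tendsto (fun k => eLpNorm (fun x => u k x - v x) 1 volume) atTop (𝓝 0))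
    (hD : Tendsto (fun k => eLpNorm (fun x => D k x - E x) p volume) atTop (𝓝 0)) :
    IsWeakGrad univ v E := by
  refine isWeakGrad_of_tendsto hp hE h (fun η hη hc _ j => ?_) (by simpa using hD)
  set w : Ev n → ℝ := fun x => fderiv ℝ η x (EuclideanSpace.single j 1) with hw
  have hwc : Continuous w := continuous_fderiv_apply hη _
  obtain ⟨M, hM⟩ := hwc.bounded_above_of_compact_support (hc.fderiv_apply (𝕜 := ℝ) _)
  simp only [Measure.restrict_univ]
  have hmul : ∀ f : Ev n → ℝ, Integrable f → Integrable (fun x => f x * w x) := fun f hf =>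
    hf.mul_bdd hwc.aestronglyMeasurable (Eventually.of_forall hM)
  refine tendsto_integral_of_L1' _ (hmul v hvi).aestronglyMeasurable (Eventually.of_forall fun k => hmul _ (hui k)) ?_
  have e1 := ENNReal.Tendsto.const_mul (a := ENNReal.ofReal M) hu (Or.inr ENNReal.ofReal_ne_top)
  rw [mul_zero] at e1
  refine tendsto_of_tendsto_of_tendsto_of_le_of_le tendsto_const_nhds e1 (fun _ => zero_le)
    fun k => ?_
  refine eLpNorm_le_mul_eLpNorm_of_ae_le_mul (Eventually.of_forall fun x => ?_) 1
  rw [Pi.sub_apply, ← sub_mul, norm_mul, mul_comm]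
  exact mul_le_mul_of_nonneg_right (hM x) (norm_nonneg _)

/-- The restriction of a test function for a disjoint union to a member of the family. -/
lemma MemTest.indicator {n : ℕ} (hn : 1 ≤ n) {p : ℝ≥0∞} (hp : 1 ≤ p) {U : ℕ → Set (Ev n)}
    (hU : ∀ i, IsOpen (U i)) (hd : Pairwise (Function.onFun Disjoint U))
    (hb : Bornology.IsBounded (⋃ i, U i)) {f : Ev n → ℝ} {Df : Ev n → Ev n}
    (h : MemTest p (⋃ j, U j) f Df) (i : ℕ) :
    MemTest p (U i) ((U i).indicator f) ((U i).indicator Df) := by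
  have hUo : IsOpen (⋃ i, U i) := isOpen_iUnion hU
  have hfi := h.integrable hUo hb
  obtain ⟨h, L, hL⟩ := h
  obtain ⟨f', hf', hae, hon, h0, hDf⟩ := h.exists_lipschitzWith hp hUo hb hL
  have hle : ∀ (r : ℝ≥0∞) (E : Ev n → Ev n),
      eLpNorm ((U i).indicator E) r volume ≤ eLpNorm E r volume := fun r E =>
    eLpNorm_indicator_le E
  have happrox : ∀ g : Ev n → ℝ, tsupport g ⊆ ⋃ i, U i →
      (fun x => (U i).indicator Df x - gradient ((U i).indicator g) x)
        = (U i).indicator (fun x => Df x - gradient g x) := by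
    intro g hg
    rw [gradient_indicator_of_disjoint hU hd hg]
    ext1 x
    by_cases hx : x ∈ U i <;> simp [hx]
  have hcs : ∀ g : Ev n → ℝ, HasCompactSupport g → tsupport g ⊆ ⋃ i, U i →
      HasCompactSupport ((U i).indicator g) := fun g hgc hg =>
    hgc.of_isClosed_subset (isClosed_tsupport _)
      ((tsupport_indicator_subset_of_disjoint hU hd hg i).trans inter_subset_left)
  refine ⟨⟨?_, fun x hx => by simp [hx], (hle _ _).trans_lt h.2.2.1, fun ε hε => ?_⟩, L,
    fun x hx y hy => ?_⟩
  · obtain ⟨R₀, hR₀⟩ := hb.closure.subset_closedBall (0 : Ev n)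
    obtain ⟨P, hP, hPoin⟩ := eLpNorm_one_le_mul_eLpNorm_gradient hn hp (max R₀ 0) (le_max_right _ _)
    have hball : ∀ x ∉ closedBall (0 : Ev n) (max R₀ 0), x ∉ closure (⋃ i, U i) := fun x hx hxA =>
      hx (closedBall_subset_closedBall (le_max_left _ _) (hR₀ hxA))
    choose g hg hgc hgs hgε using fun k : ℕ =>
      h.2.2.2 (1 / ((k : ℝ) + 1)) (by positivity)
    have hlim : Tendsto (fun k : ℕ => ENNReal.ofReal (1 / ((k : ℝ) + 1))) atTop (𝓝 0) := by
      simpa using ENNReal.tendsto_ofReal (tendsto_one_div_add_atTop_nhds_zero_nat (𝕜 := ℝ))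
    choose Lg hLg using fun k => (hg k).lipschitzWith_of_hasCompactSupport (hgc k) (by simp)
    choose Li hLi using fun k => (contDiff_indicator_of_disjoint hU hd (hg k)
      (hgs k) i).lipschitzWith_of_hasCompactSupport (hcs _ (hgc k) (hgs k)) (by simp)
    have hg1 : ∀ k, eLpNorm (fun x => f' x - g k x) 1 volume
        ≤ P * ENNReal.ofReal (1 / ((k : ℝ) + 1)) := fun k => by
      refine (hPoin _ (L + Lg k) (hf'.sub (hLg k)) fun x hx => ?_).trans ?_
      · have hx' := hball x hx
        rw [h0 x hx', image_eq_zero_of_notMem_tsupport fun hx'' => hx' (subset_closure (hgs k hx'')),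
          sub_zero]
      · rw [eLpNorm_congr_ae (gradient_sub_ae_eq hf' hDf (hg k))]
        exact mul_le_mul_right (hgε k).le _
    refine isWeakGrad_univ_of_tendsto hp (u := fun k => (U i).indicator (g k))
      (fun j => ?_) (fun k => isWeakGrad_of_lipschitz (hLi k))
      (fun k => ?_) (hfi.indicator (hU i).measurableSet) ?_ ?_
    · have h1 := (locallyIntegrableOn_univ.1 (h.1.1 j)).indicator (hU i).measurableSet
      refine locallyIntegrableOn_univ.2 (h1.congr (Eventually.of_forall fun x => ?_))
      by_cases hx : x ∈ U i <;> simp [hx]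
    · exact (hLi k).continuous.integrable_of_hasCompactSupport (hcs _ (hgc k) (hgs k))
    · have e1 := ENNReal.Tendsto.const_mul (a := P) hlim (Or.inr hP)
      rw [mul_zero] at e1
      refine tendsto_of_tendsto_of_tendsto_of_le_of_le tendsto_const_nhds e1 (fun _ => zero_le)
        fun k => (eLpNorm_mono_ae ?_).trans (hg1 k)
      filter_upwards [hae] with x hx
      by_cases hxU : x ∈ U i
      · simp only [indicator_of_mem hxU]
        rw [hx, norm_sub_rev]
      · simp [hxU]
    · refine tendsto_of_tendsto_of_tendsto_of_le_of_le tendsto_const_nhds hlim (fun _ => zero_le)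
        fun k => ?_
      beta_reduce
      refine le_trans (le_of_eq ?_) ((hle p _).trans (hgε k).le)
      rw [← happrox _ (hgs k)]
      exact eLpNorm_congr_norm_ae (Eventually.of_forall fun x => norm_sub_rev _ _)
  · obtain ⟨g, h1, h2, h3, h4⟩ := h.2.2.2 ε hε
    refine ⟨(U i).indicator g, contDiff_indicator_of_disjoint hU hd h1 h3 i, hcs g h2 h3,
      (tsupport_indicator_subset_of_disjoint hU hd h3 i).trans inter_subset_right, ?_⟩
    rw [happrox g h3]
    exact (hle _ _).trans_lt h4
  · rw [indicator_of_mem hx, indicator_of_mem hy]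
    exact hL (mem_iUnion_of_mem i hx) (mem_iUnion_of_mem i hy)

lemma tsum_mul_le_Lp_mul_Lq {P Q : ℝ} (hPQ : P.HolderConjugate Q) (f g : ℕ → ℝ≥0∞) :
    ∑' i, f i * g i ≤ (∑' i, f i ^ P) ^ (1 / P) * (∑' i, g i ^ Q) ^ (1 / Q) := by
  have hP : 0 ≤ 1 / P := by have := hPQ.pos; positivity
  have hQ : 0 ≤ 1 / Q := by have := hPQ.symm.pos; positivity
  refine ENNReal.tsum_le_of_sum_range_le fun k => ?_
  refine (ENNReal.inner_le_Lp_mul_Lq (Finset.range k) f g hPQ).trans ?_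
  gcongr <;> exact ENNReal.sum_le_tsum _

lemma le_tsum_rpow_mul_of_le {P Q σ : ℝ} (hQ : 0 < Q) (hσ : 0 < σ)
    (hexp : 1 / Q = 1 / P + 1 / σ) {a b : ℝ≥0∞} {A B s : ℕ → ℝ≥0∞}
    (ha : a ^ Q ≤ ∑' i, A i ^ Q) (hA : ∀ i, A i ≤ s i ^ (1 / σ) * B i)
    (hB : (P = 0 ∧ ∀ i, B i ≤ b) ∨ (0 < P ∧ ∑' i, B i ^ P ≤ b ^ P)) :
    a ≤ (∑' i, s i) ^ (1 / σ) * b := by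
  have hQσ : 0 ≤ 1 / σ * Q := by positivity
  have hAi : ∀ i, A i ^ Q ≤ s i ^ (1 / σ * Q) * B i ^ Q := fun i => by
    rw [ENNReal.rpow_mul, ← ENNReal.mul_rpow_of_nonneg _ _ hQ.le]
    exact ENNReal.rpow_le_rpow (hA i) hQ.le
  have key : a ^ Q ≤ (∑' i, s i) ^ (1 / σ * Q) * b ^ Q := by
    refine ha.trans ((ENNReal.tsum_le_tsum hAi).trans ?_)
    rcases hB with ⟨rfl, hB⟩ | ⟨hP, hB⟩
    · rw [div_zero, zero_add] at hexp
      rw [← hexp, one_div_mul_cancel hQ.ne']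
      simp only [ENNReal.rpow_one]
      rw [← ENNReal.tsum_mul_right]
      exact ENNReal.tsum_le_tsum fun i =>
        mul_le_mul_right (ENNReal.rpow_le_rpow (hB i) hQ.le) _
    · have hconj : (σ / Q).HolderConjugate (P / Q) := by
        refine Real.holderConjugate_iff.2 ⟨?_, ?_⟩
        · rw [one_lt_div hQ, ← one_div_lt_one_div hσ hQ, hexp]
          have : 0 < 1 / P := by positivity
          linarith
        · rw [inv_div, inv_div, div_eq_mul_one_div Q σ, div_eq_mul_one_div Q P, ← mul_add,
            add_comm (1 / σ), ← hexp, mul_one_div_cancel hQ.ne']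
      refine (tsum_mul_le_Lp_mul_Lq hconj _ _).trans ?_
      have e1 : ∀ i, (s i ^ (1 / σ * Q)) ^ (σ / Q) = s i := fun i => by
        rw [← ENNReal.rpow_mul]
        have : 1 / σ * Q * (σ / Q) = 1 := by field_simp
        rw [this, ENNReal.rpow_one]
      have e2 : ∀ i, (B i ^ Q) ^ (P / Q) = B i ^ P := fun i => by
        rw [← ENNReal.rpow_mul, mul_div_cancel₀ _ hQ.ne']
      simp only [e1, e2]
      have e3 : b ^ Q = (b ^ P) ^ (1 / (P / Q)) := by
        rw [← ENNReal.rpow_mul]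
        congr 1
        field_simp
      have e4 : 1 / (σ / Q) = 1 / σ * Q := by field_simp
      rw [e3, e4]
      gcongr
  have h1 := ENNReal.rpow_le_rpow key (by positivity : 0 ≤ 1 / Q)
  rwa [ENNReal.mul_rpow_of_nonneg _ _ (by positivity), ← ENNReal.rpow_mul, ← ENNReal.rpow_mul,
    ← ENNReal.rpow_mul, mul_assoc, mul_one_div_cancel hQ.ne', mul_one, ENNReal.rpow_one,
    ENNReal.rpow_one] at h1

lemma IsCompSetting.eLpNorm_comp_le_phiFun {n : ℕ} {Ω Ω' : Set (Ev n)} {φ : Ev n → Ev n}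
    {p q C : ℝ≥0∞} (H : IsCompSetting Ω Ω' φ p q C) {σ : ℝ} (hσ : 0 < σ) {A : Set (Ev n)}
    (hA : IsOpen A) (hb : Bornology.IsBounded A) {f : Ev n → ℝ} {Df Dv : Ev n → Ev n}
    (h : MemTest p A f Df) (hv : IsWeakGrad Ω (f ∘ φ) Dv) :
    eLpNorm Dv q (volume.restrict Ω) ≤ ENNReal.ofReal (PhiFun Ω Ω' φ p q σ A) ^ (1 / σ)
      * eLpNorm Df p (volume.restrict (A ∩ Ω')) := by
  have ha := h.eLpNorm_comp_lt_top H hA hb hv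
  have hbf := h.eLpNorm_lt_top (A ∩ Ω')
  have hs0 := phiFun_nonneg Ω Ω' φ p q σ A
  rw [ENNReal.ofReal_rpow_of_nonneg hs0 (by positivity), ← ENNReal.ofReal_toReal ha.ne,
    ← ENNReal.ofReal_toReal hbf.ne, ← ENNReal.ofReal_mul (by positivity)]
  refine ENNReal.ofReal_le_ofReal ?_
  set a := (eLpNorm Dv q (volume.restrict Ω)).toReal
  set b := (eLpNorm Df p (volume.restrict (A ∩ Ω'))).toReal with hbdef
  have hab : a ≤ C.toReal * b := h.toReal_comp_le H hA hb hv
  have hb0 : 0 ≤ b := ENNReal.toReal_nonneg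
  rcases hb0.eq_or_lt with hb0 | hb0
  · rw [← hb0, mul_zero] at hab ⊢
    exact hab
  · rw [← div_le_iff₀ hb0]
    have h1 : (a / b) ^ σ ≤ PhiFun Ω Ω' φ p q σ A := by
      rw [phiFun_eq_sSup_ratioSet]
      exact le_csSup (H.bddAbove_ratioSet hσ.le hA hb) ⟨f, Df, Dv, h, hv, rfl⟩
    have hab0 : 0 ≤ a / b := by positivity
    calc a / b = ((a / b) ^ σ) ^ (1 / σ) := by
          rw [← Real.rpow_mul hab0, mul_one_div_cancel hσ.ne', Real.rpow_one]
      _ ≤ _ := by gcongr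

lemma IsCompSetting.phiFun_iUnion_le_tsum {n : ℕ} {Ω Ω' : Set (Ev n)} {φ : Ev n → Ev n}
    {p q C : ℝ≥0∞} (H : IsCompSetting Ω Ω' φ p q C) {σ : ℝ} (hσ : 0 < σ)
    (hexp : 1 / q.toReal = 1 / p.toReal + 1 / σ) {U : ℕ → Set (Ev n)} (hU : ∀ i, IsOpen (U i))
    (hd : Pairwise (Function.onFun Disjoint U)) (hb : Bornology.IsBounded (⋃ i, U i))
    (hsum : Summable fun i => PhiFun Ω Ω' φ p q σ (U i)) :
    PhiFun Ω Ω' φ p q σ (⋃ i, U i) ≤ ∑' i, PhiFun Ω Ω' φ p q σ (U i) := by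
  have hqt : q ≠ ⊤ := H.lt.ne_top
  have hq0 : q ≠ 0 := (zero_lt_one.trans_le H.one_le).ne'
  have hQ : 0 < q.toReal := ENNReal.toReal_pos hq0 hqt
  have hUo : IsOpen (⋃ i, U i) := isOpen_iUnion hU
  have hUb : ∀ i, Bornology.IsBounded (U i) := fun i => hb.subset (subset_iUnion U i)
  rw [phiFun_eq_sSup_ratioSet]
  refine csSup_le (ratioSet_nonempty _ _ _ _ _ _ _) ?_
  rintro t ⟨f, Df, Dv, h, hv, rfl⟩
  have hT := fun i => h.indicator H.one_le_dim H.one_le_left hU hd hb i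
  have hex : ∀ i, ∃ D, IsWeakGrad Ω ((U i).indicator f ∘ φ) D := fun i => by
    obtain ⟨-, -, D, -, -, -, -, -, -, hw, -⟩ := (hT i).exists_rep H (hU i) (hUb i)
    exact ⟨D, hw⟩
  choose D hD using hex
  have hvi := hv.integrableOn_apply H.isBounded H.one_le (h.eLpNorm_comp_lt_top H hUo hb hv)
  have hloc : ∀ᵐ x ∂(volume.restrict Ω), ∀ i, φ x ∈ U i → Dv x = D i x := by
    refine ae_all_iff.2 fun i => ?_
    have hDi := (hD i).integrableOn_apply H.isBounded H.one_le
      ((hT i).eLpNorm_comp_lt_top H (hU i) (hUb i) (hD i))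
    have hi1 := h.integrableOn_comp H hUo hb
    have hi2 : IntegrableOn (fun x => -1 * ((U i).indicator f ∘ φ) x) Ω :=
      ((hT i).integrableOn_comp H (hU i) (hUb i)).const_mul (-1)
    have hsub := hv.add ((hD i).const_smul (-1)) hi1 hi2
    filter_upwards [hsub.ae_eq_zero H.isOpen (hi1.add hi2)
      (fun j => (hvi j).add ((hDi j).const_mul (-1)))] with x hx hxU
    have := hx (by simp [hxU])
    rwa [neg_smul, one_smul, ← sub_eq_add_neg, sub_eq_zero] at this
  have ha : eLpNorm Dv q (volume.restrict Ω) ^ q.toReal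
      ≤ ∑' i, eLpNorm (D i) q (volume.restrict Ω) ^ q.toReal := by
    simp only [eLpNorm_rpow_toReal hq0 hqt]
    rw [← lintegral_tsum fun i => (hD i).aestronglyMeasurable.enorm.pow_const _]
    refine lintegral_mono_ae ?_
    filter_upwards [hloc, h.comp_ae_eq_zero H hUo hb hv] with x hx hx0
    by_cases hxU : φ x ∈ ⋃ i, U i
    · obtain ⟨i, hi⟩ := mem_iUnion.1 hxU
      rw [hx i hi]
      exact ENNReal.le_tsum i
    · simp [hx0 hxU, hQ]
  have hBi : ∀ i, eLpNorm ((U i).indicator Df) p (volume.restrict (U i ∩ Ω'))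
      = eLpNorm Df p (volume.restrict (U i ∩ Ω')) := fun i => by
    refine eLpNorm_congr_ae ?_
    filter_upwards [ae_restrict_mem ((hU i).inter H.isOpen_target).measurableSet] with x hx
    simp [hx.1]
  have hle := le_tsum_rpow_mul_of_le (P := p.toReal) hQ hσ hexp ha
    (b := eLpNorm Df p (volume.restrict ((⋃ i, U i) ∩ Ω')))
    (fun i => H.eLpNorm_comp_le_phiFun hσ (hU i) (hUb i) (hT i) (hD i)) ?_
  · rw [← ENNReal.ofReal_tsum_of_nonneg (fun i => phiFun_nonneg _ _ _ _ _ _ _) hsum] at hle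
    set S := ∑' i, PhiFun Ω Ω' φ p q σ (U i) with hS
    have hS0 : 0 ≤ S := tsum_nonneg fun i => phiFun_nonneg _ _ _ _ _ _ _
    rw [ENNReal.ofReal_rpow_of_nonneg hS0 (by positivity)] at hle
    have h2 := ENNReal.toReal_mono
      (ENNReal.mul_lt_top ENNReal.ofReal_lt_top (h.eLpNorm_lt_top _)).ne hle
    rw [ENNReal.toReal_mul, ENNReal.toReal_ofReal (by positivity)] at h2
    calc _ ≤ (S ^ (1 / σ)) ^ σ := by
          refine Real.rpow_le_rpow (by positivity) ?_ hσ.le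
          exact div_le_of_le_mul₀ ENNReal.toReal_nonneg (by positivity) h2
      _ = S := by rw [← Real.rpow_mul hS0, one_div_mul_cancel hσ.ne', Real.rpow_one]
  · simp only [hBi]
    rcases eq_or_ne p ⊤ with rfl | hpt
    · exact Or.inl ⟨rfl, fun i => eLpNorm_mono_measure _ (Measure.restrict_mono
        (inter_subset_inter_left _ (subset_iUnion U i)) le_rfl)⟩
    · have hp0 : p ≠ 0 := (zero_lt_one.trans_le H.one_le_left).ne'
      refine Or.inr ⟨ENNReal.toReal_pos hp0 hpt, le_of_eq ?_⟩
      simp only [eLpNorm_rpow_toReal hp0 hpt]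
      rw [iUnion_inter, lintegral_iUnion
        (fun i => ((hU i).inter H.isOpen_target).measurableSet)]
      exact fun i j hij => (hd hij).mono inter_subset_left inter_subset_left

lemma IsCompSetting.sum_phiFun_le {n : ℕ} {Ω Ω' : Set (Ev n)} {φ : Ev n → Ev n} {p q C : ℝ≥0∞}
    (H : IsCompSetting Ω Ω' φ p q C) {σ : ℝ} (hσ : 0 < σ)
    (hexp : 1 / q.toReal = 1 / p.toReal + 1 / σ) {U : ℕ → Set (Ev n)} (hU : ∀ i, IsOpen (U i))
    (hd : Pairwise (Function.onFun Disjoint U)) (hb : Bornology.IsBounded (⋃ i, U i))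
    (F : Finset ℕ) :
    ∑ i ∈ F, PhiFun Ω Ω' φ p q σ (U i) ≤ PhiFun Ω Ω' φ p q σ (⋃ i, U i) := by
  refine le_of_forall_pos_le_add fun ε hε => ?_
  have hex : ∀ i, ∃ t ∈ ratioSet Ω Ω' φ p q σ (U i),
      PhiFun Ω Ω' φ p q σ (U i) - ε / (F.card + 1) < t := fun i => by
    rw [phiFun_eq_sSup_ratioSet]
    exact exists_lt_of_lt_csSup (ratioSet_nonempty _ _ _ _ _ _ _)
      (sub_lt_self _ (by positivity))
  choose t ht hlt using hex
  calc ∑ i ∈ F, PhiFun Ω Ω' φ p q σ (U i) ≤ ∑ i ∈ F, (t i + ε / (F.card + 1)) :=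
        Finset.sum_le_sum fun i _ => by linarith [hlt i]
    _ = ∑ i ∈ F, t i + F.card * (ε / (F.card + 1)) := by
        rw [Finset.sum_add_distrib, Finset.sum_const, nsmul_eq_mul]
    _ ≤ PhiFun Ω Ω' φ p q σ (⋃ i, U i) + ε := by
        refine add_le_add (H.sum_le_phiFun hσ hexp hU hd hb ht F) ?_
        rw [mul_div_assoc', div_le_iff₀ (by positivity)]
        nlinarith

/-- Countable additivity. -/
lemma IsCompSetting.tsum_phiFun_eq {n : ℕ} {Ω Ω' : Set (Ev n)} {φ : Ev n → Ev n} {p q C : ℝ≥0∞}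
    (H : IsCompSetting Ω Ω' φ p q C) {σ : ℝ} (hσ : 0 < σ)
    (hexp : 1 / q.toReal = 1 / p.toReal + 1 / σ) {U : ℕ → Set (Ev n)} (hU : ∀ i, IsOpen (U i))
    (hd : Pairwise (Function.onFun Disjoint U)) (hb : Bornology.IsBounded (⋃ i, U i)) :
    ∑' i, PhiFun Ω Ω' φ p q σ (U i) = PhiFun Ω Ω' φ p q σ (⋃ i, U i) := by
  have hle := H.sum_phiFun_le hσ hexp hU hd hb
  have hsum := summable_of_sum_le (fun i => phiFun_nonneg Ω Ω' φ p q σ (U i)) hle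
  exact le_antisymm (hsum.tsum_le_of_sum_le hle) (H.phiFun_iUnion_le_tsum hσ hexp hU hd hb hsum)

lemma exponent_pos_and_eq {p q : ℝ≥0∞} (hq : 1 ≤ q) (hqp : q < p) {σ : ℝ}
    (hσ : σ = if p = ⊤ then q.toReal else p.toReal * q.toReal / (p.toReal - q.toReal)) :
    0 < σ ∧ 1 / q.toReal = 1 / p.toReal + 1 / σ := by
  have hQ : 0 < q.toReal := ENNReal.toReal_pos (zero_lt_one.trans_le hq).ne' hqp.ne_top
  split_ifs at hσ with hpt
  · subst hσ hpt
    simpa using hQ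
  · have hlt : q.toReal < p.toReal := ENNReal.toReal_strict_mono hpt hqp
    have hsub : 0 < p.toReal - q.toReal := sub_pos.2 hlt
    have hP : 0 < p.toReal := hQ.trans hlt
    refine ⟨by rw [hσ]; positivity, ?_⟩
    rw [hσ]
    field_simp
    ring

/-- Lemma 2.4.  If `φ : Ω → Ω̄'` induces a bounded composition
operator `φ* : L¹_p(Ω') ∩ Lip(Ω') → L¹_q(Ω)`, `1 ≤ q < p ≤ ∞`, then, with
`σ = pq/(p−q)` for `p < ∞` and `σ = q` for `p = ∞`, the function `Φ` is a bounded,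
monotone, countably additive set function on bounded open sets meeting `Ω'`. -/
theorem statement6 (n : ℕ) (hn : 1 ≤ n)
    (Ω Ω' : Set (Ev n))
    (hΩ : IsBoundedDomain Ω) (hΩ' : IsBoundedDomain Ω')
    (φ : Ev n → Ev n)
    (hmeas : AEMeasurable φ (volume.restrict Ω))
    (hmaps : MapsTo φ Ω (closure Ω'))
    (p q : ℝ≥0∞) (hq : 1 ≤ q) (hqp : q < p)
    (C : ℝ≥0∞) (hC : C < ⊤)
    (hcomp : CompOpBoundedLip Ω Ω' φ p q C) :
    (∃ B : ℝ, ∀ A : Set (Ev n), IsOpen A → Bornology.IsBounded A → (A ∩ Ω').Nonempty →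
      PhiFun Ω Ω' φ p q (if p = ⊤ then q.toReal else p.toReal * q.toReal / (p.toReal - q.toReal)) A ≤ B) ∧
    (∀ A₁ A₂ : Set (Ev n), IsOpen A₁ → Bornology.IsBounded A₁ → (A₁ ∩ Ω').Nonempty →
      IsOpen A₂ → Bornology.IsBounded A₂ → (A₂ ∩ Ω').Nonempty → A₁ ⊆ A₂ →
      PhiFun Ω Ω' φ p q (if p = ⊤ then q.toReal else p.toReal * q.toReal / (p.toReal - q.toReal)) A₁ ≤
      PhiFun Ω Ω' φ p q (if p = ⊤ then q.toReal else p.toReal * q.toReal / (p.toReal - q.toReal)) A₂) ∧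
    (∀ U : ℕ → Set (Ev n),
      (∀ i, IsOpen (U i) ∧ Bornology.IsBounded (U i) ∧ (U i ∩ Ω').Nonempty) →
      Pairwise (Function.onFun Disjoint U) →
      Bornology.IsBounded (⋃ i, U i) →
      ∑' i, PhiFun Ω Ω' φ p q (if p = ⊤ then q.toReal else p.toReal * q.toReal / (p.toReal - q.toReal)) (U i)
        = PhiFun Ω Ω' φ p q (if p = ⊤ then q.toReal else p.toReal * q.toReal / (p.toReal - q.toReal)) (⋃ i, U i)) := by
  set σ : ℝ := if p = ⊤ then q.toReal else p.toReal * q.toReal / (p.toReal - q.toReal) with hσdef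
  obtain ⟨hσ, hexp⟩ := exponent_pos_and_eq hq hqp hσdef
  have H : IsCompSetting Ω Ω' φ p q C := ⟨hn, hΩ.1, hΩ.2.2, hΩ'.1, hmeas, hq, hqp, hC, hcomp⟩
  refine ⟨⟨C.toReal ^ σ, fun A hA hb _ => ?_⟩, fun A₁ A₂ hA₁ hb₁ _ hA₂ hb₂ _ hsub =>
    H.phiFun_mono hσ.le hA₁ hb₁ hA₂ hb₂ hsub, fun U hU hd hb =>
    H.tsum_phiFun_eq hσ hexp (fun i => (hU i).1) hd hb⟩
  rw [phiFun_eq_sSup_ratioSet]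
  exact csSup_le (ratioSet_nonempty _ _ _ _ _ _ _) fun t ht => H.ratio_le hσ.le hA hb ht

end Paper
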